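/- arXiv:2205.14291 — 3 statements merged into one kernel-verified Lean document; each statement's English description precedes it below -/
import Mathlib

section
/- There exists a constant C > 0 depending only on n with the following property: if u is continuous on B₁⁺ ∪ T₁, harmonic on B₁⁺, u ≥ 0 on B₁⁺, u = 0 on T₁, and u(eₙ/2) = 1, then u(x) ≥ C·xₙ for every x ∈ B₁⸝₂⁺. -/
noncomputable section

/-- The Laplacian of `u : ℝⁿ → ℝ`. -/
def lapl {m : ℕ} (u : EuclideanSpace ℝ (Fin m) → ℝ) (x : EuclideanSpace ℝ (Fin m)) : ℝ :=
  ∑ i : Fin m, fderiv ℝ (fun y => fderiv ℝ u y (EuclideanSpace.single i 1)) x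
    (EuclideanSpace.single i 1)

/-- Harmonic on an open set: C² with vanishing Laplacian. -/
def IsHarmonicOn {m : ℕ} (u : EuclideanSpace ℝ (Fin m) → ℝ)
    (U : Set (EuclideanSpace ℝ (Fin m))) : Prop :=
  ContDiffOn ℝ 2 u U ∧ ∀ x ∈ U, lapl u x = 0

/-- The unit vector `eₙ` in dimension `n + 2`. -/
def en (n : ℕ) : EuclideanSpace ℝ (Fin (n + 2)) := EuclideanSpace.single (Fin.last (n + 1)) 1

/-- The upper half ball `B_r⁺`. -/
def halfBall (n : ℕ) (r : ℝ) : Set (EuclideanSpace ℝ (Fin (n + 2))) :=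
  {x | ‖x‖ < r ∧ 0 < x (Fin.last (n + 1))}

/-- The flat boundary part `T_r`. -/
def flatT (n : ℕ) (r : ℝ) : Set (EuclideanSpace ℝ (Fin (n + 2))) :=
  {x | ‖x‖ < r ∧ x (Fin.last (n + 1)) = 0}

section WeightedMean

open MeasureTheory Metric Set Filter Topology

theorem hasDerivAt_max_zero_pow_three (s : ℝ) :
    HasDerivAt (fun s : ℝ => max s 0 ^ 3) (3 * max s 0 ^ 2) s := by
  have h1 : HasDerivAt (fun s : ℝ => (s ^ 3 + |s| ^ (3 : ℝ)) / 2)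
      ((3 * s ^ 2 + 3 * |s| ^ ((3 : ℝ) - 2) * s) / 2) s := by
    have := ((hasDerivAt_pow 3 s).add (hasDerivAt_abs_rpow s (p := 3) (by norm_num))).div_const 2
    refine (this.congr_deriv ?_)
    norm_num
  convert h1 using 1
  · funext t
    rw [show (3 : ℝ) = ((3 : ℕ) : ℝ) by norm_num, Real.rpow_natCast]
    rcases le_total t 0 with h | h
    · rw [max_eq_right h, abs_of_nonpos h]; ring
    · rw [max_eq_left h, abs_of_nonneg h]; ring
  · rw [show (3 : ℝ) - 2 = 1 by norm_num, Real.rpow_one]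
    rcases le_total s 0 with h | h
    · rw [max_eq_right h, abs_of_nonpos h]; ring
    · rw [max_eq_left h, abs_of_nonneg h]; ring

/-- The radial weight `(1 - |z|²)₊ ^ k`. -/
def radialWeight {m : ℕ} (k : ℕ) (z : EuclideanSpace ℝ (Fin m)) : ℝ := max (1 - ‖z‖ ^ 2) 0 ^ k

section RadialWeight

variable {m : ℕ}

theorem continuous_radialWeight (k : ℕ) :
    Continuous (radialWeight k : EuclideanSpace ℝ (Fin m) → ℝ) := by
  unfold radialWeight; fun_prop

theorem radialWeight_nonneg (k : ℕ) (z : EuclideanSpace ℝ (Fin m)) : 0 ≤ radialWeight k z :=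
  pow_nonneg (le_max_right _ _) _

theorem radialWeight_eq_zero {k : ℕ} (hk : k ≠ 0) {z : EuclideanSpace ℝ (Fin m)}
    (hz : 1 ≤ ‖z‖) : radialWeight k z = 0 := by
  rw [radialWeight, max_eq_right (by nlinarith), zero_pow hk]

theorem hasCompactSupport_radialWeight {k : ℕ} (hk : k ≠ 0) :
    HasCompactSupport (radialWeight k : EuclideanSpace ℝ (Fin m) → ℝ) := by
  refine HasCompactSupport.intro (isCompact_closedBall 0 1) fun z hz => ?_
  refine radialWeight_eq_zero hk ?_
  simp only [mem_closedBall, dist_zero_right, not_le] at hz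
  exact hz.le

theorem integral_radialWeight_pos :
    0 < ∫ z : EuclideanSpace ℝ (Fin m), radialWeight 2 z := by
  refine (continuous_radialWeight 2).integral_pos_of_hasCompactSupport_nonneg_nonzero
    (hasCompactSupport_radialWeight two_ne_zero) (radialWeight_nonneg 2) (x := 0) ?_
  simp [radialWeight]

theorem hasFDerivAt_radialWeight_three (z : EuclideanSpace ℝ (Fin m)) :
    HasFDerivAt (radialWeight 3) (-(6 * radialWeight 2 z) • innerSL ℝ z) z := by
  have h1 : HasFDerivAt (fun z : EuclideanSpace ℝ (Fin m) => 1 - ‖z‖ ^ 2)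
      (-(2 • innerSL ℝ z)) z := (hasStrictFDerivAt_norm_sq z).hasFDerivAt.const_sub 1
  have h2 := (hasDerivAt_max_zero_pow_three (1 - ‖z‖ ^ 2)).comp_hasFDerivAt z h1
  refine h2.congr_fderiv ?_
  ext v
  simp [radialWeight]
  ring

theorem differentiable_radialWeight_three :
    Differentiable ℝ (radialWeight 3 : EuclideanSpace ℝ (Fin m) → ℝ) :=
  fun z => (hasFDerivAt_radialWeight_three z).differentiableAt

theorem fderiv_radialWeight_three_single (z : EuclideanSpace ℝ (Fin m)) (i : Fin m) :
    fderiv ℝ (radialWeight 3) z (EuclideanSpace.single i 1) = -6 * (z i * radialWeight 2 z) := by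
  rw [(hasFDerivAt_radialWeight_three z).fderiv]
  simp [EuclideanSpace.inner_single_right]
  ring

end RadialWeight

section MeanValue

variable {m : ℕ} {v : EuclideanSpace ℝ (Fin m) → ℝ}

theorem sum_apply_single (L : EuclideanSpace ℝ (Fin m) →L[ℝ] ℝ) (z : EuclideanSpace ℝ (Fin m)) :
    L z = ∑ i, z i * L (EuclideanSpace.single i 1) := by
  conv_lhs => rw [← (EuclideanSpace.basisFun (Fin m) ℝ).sum_repr z]
  simp

theorem integral_partial_mul_radialWeight (hv : ContDiff ℝ 2 v) (y : EuclideanSpace ℝ (Fin m))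
    (t : ℝ) (i : Fin m) :
    6 * ∫ z, fderiv ℝ v (y + t • z) (EuclideanSpace.single i 1) * (z i * radialWeight 2 z) =
      t * ∫ z, fderiv ℝ (fun w => fderiv ℝ v w (EuclideanSpace.single i 1)) (y + t • z)
        (EuclideanSpace.single i 1) * radialWeight 3 z := by
  set e : EuclideanSpace ℝ (Fin m) := EuclideanSpace.single i 1 with he
  have hd : ContDiff ℝ 1 (fun w => fderiv ℝ v w e) :=
    (hv.fderiv_right (m := 1) (by norm_num)).clm_apply contDiff_const
  have hdc : Continuous (fun z => fderiv ℝ v (y + t • z) e) :=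
    hd.continuous.comp (by fun_prop)
  have hddc : Continuous (fun z => fderiv ℝ (fun w => fderiv ℝ v w e) (y + t • z) e) :=
    ((hd.continuous_fderiv (by norm_num)).clm_apply continuous_const).comp (by fun_prop)
  have hf : ∀ z, HasFDerivAt (fun z => fderiv ℝ v (y + t • z) e)
      (t • fderiv ℝ (fun w => fderiv ℝ v w e) (y + t • z)) z := by
    intro z
    have h1 : HasFDerivAt (fun z : EuclideanSpace ℝ (Fin m) => y + t • z)
        (t • ContinuousLinearMap.id ℝ (EuclideanSpace ℝ (Fin m))) z :=
      ((hasFDerivAt_id z).const_smul t).const_add y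
    have h2 := ((hd.differentiable (by norm_num) (y + t • z)).hasFDerivAt).comp z h1
    refine h2.congr_fderiv ?_
    ext w
    simp
  have hfd : ∀ z, fderiv ℝ (fun z => fderiv ℝ v (y + t • z) e) z e =
      t * fderiv ℝ (fun w => fderiv ℝ v w e) (y + t • z) e := by
    intro z; rw [(hf z).fderiv]; simp
  have key : ∫ z, fderiv ℝ v (y + t • z) e * fderiv ℝ (radialWeight 3) z e =
      -∫ z, fderiv ℝ (fun z => fderiv ℝ v (y + t • z) e) z e * radialWeight 3 z := by
    refine integral_mul_fderiv_eq_neg_fderiv_mul_of_integrable ?_ ?_ ?_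
      (fun z _ => (hf z).differentiableAt) (fun z _ => differentiable_radialWeight_three z)
    · simp only [hfd]
      exact ((continuous_const.mul hddc).mul (continuous_radialWeight 3)).integrable_of_hasCompactSupport
        (hasCompactSupport_radialWeight three_ne_zero).mul_left
    · simp only [he, fderiv_radialWeight_three_single]
      refine Continuous.integrable_of_hasCompactSupport
        (hdc.mul (continuous_const.mul (Continuous.mul (by fun_prop) (continuous_radialWeight 2)))) ?_
      exact (((hasCompactSupport_radialWeight two_ne_zero).mul_left).mul_left).mul_left
    · exact (hdc.mul (continuous_radialWeight 3)).integrable_of_hasCompactSupport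
        (hasCompactSupport_radialWeight three_ne_zero).mul_left
  simp only [hfd] at key
  simp only [he, fderiv_radialWeight_three_single] at key
  rw [← integral_const_mul, ← integral_const_mul, ← neg_inj]
  convert key using 1
  · rw [← integral_neg]; congr 1; ext z; ring
  · congr 2; ext z; simp only [he]; ring

theorem hasDerivAt_weighted_mean (hv : ContDiff ℝ 2 v) (hc : HasCompactSupport v)
    (y : EuclideanSpace ℝ (Fin m)) (t : ℝ) :
    HasDerivAt (fun t : ℝ => ∫ z, v (y + t • z) * radialWeight 2 z)
      (t / 6 * ∫ z, lapl v (y + t • z) * radialWeight 3 z) t := by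
  have hfc : Continuous (fderiv ℝ v) := hv.continuous_fderiv (by norm_num)
  obtain ⟨M, hM⟩ := (hc.fderiv (𝕜 := ℝ)).exists_bound_of_continuous hfc
  have hF := hasDerivAt_integral_of_dominated_loc_of_deriv_le
    (μ := (volume : Measure (EuclideanSpace ℝ (Fin m)))) (s := univ) (x₀ := t)
    (F := fun (t : ℝ) z => v (y + t • z) * radialWeight 2 z)
    (F' := fun (t : ℝ) z => fderiv ℝ v (y + t • z) z * radialWeight 2 z)
    (bound := fun z => M * ‖z‖ * radialWeight 2 z) univ_mem ?_ ?_ ?_ ?_ ?_ ?_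
  · refine hF.2.congr_deriv ?_
    have hint : ∀ i ∈ (Finset.univ : Finset (Fin m)), Integrable (fun z =>
        fderiv ℝ v (y + t • z) (EuclideanSpace.single i 1) * (z i * radialWeight 2 z)) := by
      intro i _
      refine Continuous.integrable_of_hasCompactSupport
        (((hfc.comp (by fun_prop)).clm_apply continuous_const).mul
          (Continuous.mul (by fun_prop) (continuous_radialWeight 2))) ?_
      exact ((hasCompactSupport_radialWeight two_ne_zero).mul_left).mul_left
    have hint2 : ∀ i ∈ (Finset.univ : Finset (Fin m)), Integrable (fun z =>
        fderiv ℝ (fun w => fderiv ℝ v w (EuclideanSpace.single i 1)) (y + t • z)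
        (EuclideanSpace.single i 1) * radialWeight 3 z) := by
      intro i _
      have hd : ContDiff ℝ 1 (fun w => fderiv ℝ v w (EuclideanSpace.single i 1)) :=
        (hv.fderiv_right (m := 1) (by norm_num)).clm_apply contDiff_const
      have hddc : Continuous (fun z => fderiv ℝ (fun w => fderiv ℝ v w (EuclideanSpace.single i 1))
          (y + t • z) (EuclideanSpace.single i 1)) :=
        ((hd.continuous_fderiv (by norm_num)).clm_apply continuous_const).comp (by fun_prop)
      exact (hddc.mul (continuous_radialWeight 3)).integrable_of_hasCompactSupport
        (hasCompactSupport_radialWeight three_ne_zero).mul_left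
    have e1 : ∀ z, fderiv ℝ v (y + t • z) z * radialWeight 2 z = ∑ i,
        fderiv ℝ v (y + t • z) (EuclideanSpace.single i 1) * (z i * radialWeight 2 z) := by
      intro z
      conv_lhs => rw [sum_apply_single (fderiv ℝ v (y + t • z)) z, Finset.sum_mul]
      exact Finset.sum_congr rfl fun i _ => by ring
    simp only [e1, lapl, Finset.sum_mul]
    rw [integral_finsetSum _ hint, integral_finsetSum _ hint2, Finset.mul_sum]
    refine Finset.sum_congr rfl fun i _ => ?_
    linarith [integral_partial_mul_radialWeight hv y t i]
  · exact Eventually.of_forall fun s => Continuous.aestronglyMeasurable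
      ((hv.continuous.comp (by fun_prop)).mul (continuous_radialWeight 2))
  · exact Continuous.integrable_of_hasCompactSupport
      ((hv.continuous.comp (by fun_prop)).mul (continuous_radialWeight 2))
      (hasCompactSupport_radialWeight two_ne_zero).mul_left
  · exact Continuous.aestronglyMeasurable
      (((hfc.comp (by fun_prop)).clm_apply continuous_id).mul (continuous_radialWeight 2))
  · refine Eventually.of_forall fun z s _ => ?_
    rw [norm_mul, Real.norm_of_nonneg (radialWeight_nonneg 2 z)]
    gcongr
    · exact radialWeight_nonneg 2 z
    · exact (ContinuousLinearMap.le_opNorm _ _).trans (by gcongr; exact hM _)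
  · exact Continuous.integrable_of_hasCompactSupport
      ((by fun_prop : Continuous fun z : EuclideanSpace ℝ (Fin m) => M * ‖z‖).mul
        (continuous_radialWeight 2)) (hasCompactSupport_radialWeight two_ne_zero).mul_left
  · refine Eventually.of_forall fun z s _ => ?_
    have h1 : HasDerivAt (fun s : ℝ => y + s • z) z s := by
      simpa using ((hasDerivAt_id s).smul_const z).const_add y
    exact ((hv.differentiable (by norm_num) _).hasFDerivAt.comp_hasDerivAt s h1).mul_const _

theorem weighted_mean_eq_of_lapl_eq_zero (hv : ContDiff ℝ 2 v) (hc : HasCompactSupport v)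
    {y : EuclideanSpace ℝ (Fin m)} {R : ℝ} (hR : 0 ≤ R) (h0 : ∀ x ∈ ball y R, lapl v x = 0) :
    ∫ z, v (y + R • z) * radialWeight 2 z = v y * ∫ z : EuclideanSpace ℝ (Fin m), radialWeight 2 z := by
  have hderiv : ∀ t ∈ Ico 0 R, HasDerivWithinAt
      (fun t : ℝ => ∫ z, v (y + t • z) * radialWeight 2 z) 0 (Ici t) t := by
    intro t ht
    have h1 : ∀ z, lapl v (y + t • z) * radialWeight 3 z = 0 := by
      intro z
      rcases le_or_gt 1 ‖z‖ with h | h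
      · rw [radialWeight_eq_zero three_ne_zero h, mul_zero]
      · rw [h0, zero_mul]
        rw [mem_ball, dist_self_add_left, norm_smul, Real.norm_of_nonneg ht.1]
        nlinarith [ht.1, ht.2]
    have := hasDerivAt_weighted_mean hv hc y t
    simp only [h1, integral_zero, mul_zero] at this
    exact this.hasDerivWithinAt
  have := constant_of_has_deriv_right_zero
    (fun t _ => (hasDerivAt_weighted_mean hv hc y t).continuousAt.continuousWithinAt) hderiv R
    ⟨hR, le_rfl⟩
  simpa [integral_const_mul] using this

theorem weighted_mean_eq {u : EuclideanSpace ℝ (Fin m) → ℝ} {U : Set (EuclideanSpace ℝ (Fin m))}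
    (hU : IsOpen U) (hu : IsHarmonicOn u U) {y : EuclideanSpace ℝ (Fin m)} {R : ℝ} (hR : 0 < R)
    (hy : closedBall y R ⊆ U) :
    ∫ z, u (y + R • z) * radialWeight 2 z = u y * ∫ z : EuclideanSpace ℝ (Fin m), radialWeight 2 z := by
  obtain ⟨δ, hδ, hsub⟩ := (isCompact_closedBall y R).exists_cthickening_subset_open hU hy
  rw [cthickening_closedBall hδ.le hR.le] at hsub
  let χ : ContDiffBump y := ⟨R, δ + R, hR, by linarith⟩
  set v : EuclideanSpace ℝ (Fin m) → ℝ := fun x => χ x * u x with hvdef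
  have hχ : ∀ x ∈ closedBall y R, χ x = 1 := fun x hx => χ.one_of_mem_closedBall hx
  have hvc : HasCompactSupport v := χ.hasCompactSupport.mul_right
  have hv : ContDiff ℝ 2 v := by
    refine contDiff_iff_contDiffAt.2 fun x => ?_
    by_cases hx : x ∈ tsupport v
    swap
    · exact contDiffAt_const.congr_of_eventuallyEq (notMem_tsupport_iff_eventuallyEq.1 hx)
    have hx' : x ∈ U := by
      refine hsub ?_
      have := tsupport_mul_subset_left hx
      rwa [χ.tsupport_eq] at this
    exact χ.contDiffAt.mul (hu.1.contDiffAt (hU.mem_nhds hx'))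
  have hv0 : ∀ x ∈ ball y R, lapl v x = 0 := by
    intro x hx
    rw [← hu.2 x (hy (ball_subset_closedBall hx))]
    have he : v =ᶠ[𝓝 x] u := by
      filter_upwards [isOpen_ball.mem_nhds hx] with w hw
      simp [hvdef, hχ w (ball_subset_closedBall hw)]
    unfold lapl
    refine Finset.sum_congr rfl fun i _ => ?_
    have h2 : (fun w => fderiv ℝ v w (EuclideanSpace.single i 1)) =ᶠ[𝓝 x]
        (fun w => fderiv ℝ u w (EuclideanSpace.single i 1)) := by
      filter_upwards [he.fderiv (𝕜 := ℝ)] with w hw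
      rw [hw]
    rw [h2.fderiv_eq]
  have key := weighted_mean_eq_of_lapl_eq_zero hv hvc hR.le hv0
  rw [show v y = u y by simp [hvdef, hχ y (mem_closedBall_self hR.le)]] at key
  rw [← key]
  congr 1
  ext z
  rcases le_or_gt 1 ‖z‖ with h | h
  · rw [radialWeight_eq_zero two_ne_zero h, mul_zero, mul_zero]
  · rw [hvdef]
    simp only
    rw [hχ, one_mul]
    rw [mem_closedBall, dist_self_add_left, norm_smul, Real.norm_of_nonneg hR.le]
    nlinarith

end MeanValue

end WeightedMean

section Harnack

open MeasureTheory Metric Set Filter Topology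

variable {m : ℕ} {u : EuclideanSpace ℝ (Fin m) → ℝ} {U : Set (EuclideanSpace ℝ (Fin m))}

theorem continuous_comp_mul_radialWeight (hU : IsOpen U) (hu : ContinuousOn u U)
    {y : EuclideanSpace ℝ (Fin m)} {R : ℝ} (hR : 0 < R) (hy : closedBall y R ⊆ U) :
    Continuous fun z => u (y + R • z) * radialWeight 2 z := by
  refine continuous_iff_continuousAt.2 fun z => ?_
  rcases le_or_gt ‖z‖ 1 with h | h
  · have hz : y + R • z ∈ U := by
      refine hy ?_
      rw [mem_closedBall, dist_self_add_left, norm_smul, Real.norm_of_nonneg hR.le]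
      nlinarith
    have h1 : ContinuousAt u (y + R • z) := hu.continuousAt (hU.mem_nhds hz)
    have h2 : ContinuousAt (fun z => u (y + R • z)) z :=
      ContinuousAt.comp (f := fun z => y + R • z) h1 (by fun_prop)
    exact h2.mul (continuous_radialWeight 2).continuousAt
  · refine (continuousAt_const (y := (0 : ℝ))).congr ?_
    filter_upwards [(isOpen_lt continuous_const continuous_norm).mem_nhds h] with w hw
    rw [radialWeight_eq_zero two_ne_zero (le_of_lt hw), mul_zero]

theorem radialWeight_le_radialWeight_half {a : EuclideanSpace ℝ (Fin m)} (ha : ‖a‖ ≤ 1 / 4)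
    (z : EuclideanSpace ℝ (Fin m)) :
    49 / 256 * radialWeight 2 z ≤ radialWeight 2 (a + (1 / 2 : ℝ) • z) := by
  rcases le_or_gt 1 ‖z‖ with h | h
  · rw [radialWeight_eq_zero two_ne_zero h, mul_zero]
    exact radialWeight_nonneg 2 _
  · have h1 : ‖a + (1 / 2 : ℝ) • z‖ ≤ 3 / 4 := by
      refine (norm_add_le _ _).trans ?_
      rw [norm_smul, Real.norm_of_nonneg (by norm_num)]
      linarith
    have h2 : radialWeight 2 z ≤ 1 :=
      pow_le_one₀ (le_max_right _ _) (max_le (by nlinarith [sq_nonneg ‖z‖]) zero_le_one)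
    have h3 : (7 / 16 : ℝ) ^ 2 ≤ radialWeight 2 (a + (1 / 2 : ℝ) • z) := by
      refine pow_le_pow_left₀ (by norm_num) (le_max_of_le_left ?_) 2
      nlinarith [norm_nonneg (a + (1 / 2 : ℝ) • z)]
    linarith

theorem harnack_step (hU : IsOpen U) (hu : IsHarmonicOn u U) (h0 : ∀ x ∈ U, 0 ≤ u x)
    {x y : EuclideanSpace ℝ (Fin m)} {ρ : ℝ} (hρ : 0 < ρ) (hx : closedBall x (2 * ρ) ⊆ U)
    (hxy : ‖y - x‖ ≤ ρ / 2) : 49 / 256 * (1 / 2) ^ m * u y ≤ u x := by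
  have hy : closedBall y ρ ⊆ U := by
    refine (closedBall_subset_closedBall' ?_).trans hx
    rw [dist_eq_norm]; linarith
  have hcont := hu.1.continuousOn
  set g : EuclideanSpace ℝ (Fin m) → ℝ := fun z => u (x + (2 * ρ) • z) * radialWeight 2 z with hg
  set f : EuclideanSpace ℝ (Fin m) → ℝ := fun z => u (y + ρ • z) * radialWeight 2 z with hf
  set a : EuclideanSpace ℝ (Fin m) := (2 * ρ)⁻¹ • (y - x) with ha
  have ha4 : ‖a‖ ≤ 1 / 4 := by
    rw [ha, norm_smul, Real.norm_of_nonneg (by positivity), inv_mul_le_iff₀ (by positivity)]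
    linarith
  have hfi : Integrable f :=
    (continuous_comp_mul_radialWeight hU hcont hρ hy).integrable_of_hasCompactSupport
      (hasCompactSupport_radialWeight two_ne_zero).mul_left
  have hgi : Integrable g :=
    (continuous_comp_mul_radialWeight hU hcont (by positivity) hx).integrable_of_hasCompactSupport
      (hasCompactSupport_radialWeight two_ne_zero).mul_left
  have hgi' : Integrable fun z => g (a + (1 / 2 : ℝ) • z) :=
    (hgi.comp_add_left a).comp_smul (by norm_num)
  have hfm : ∫ z, f z = u y * ∫ z : EuclideanSpace ℝ (Fin m), radialWeight 2 z :=
    weighted_mean_eq hU hu hρ hy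
  have hgm : ∫ z, g z = u x * ∫ z : EuclideanSpace ℝ (Fin m), radialWeight 2 z :=
    weighted_mean_eq hU hu (by positivity) hx
  have hg' : ∫ z, g (a + (1 / 2 : ℝ) • z) = 2 ^ m * ∫ z, g z := by
    rw [Measure.integral_comp_smul volume (fun z => g (a + z)), integral_add_left_eq_self g a,
      finrank_euclideanSpace_fin, abs_of_nonneg (by positivity), smul_eq_mul]
    simp
  have hle : ∫ z, 49 / 256 * f z ≤ ∫ z, g (a + (1 / 2 : ℝ) • z) := by
    refine integral_mono (hfi.const_mul _) hgi' fun z => ?_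
    have he : x + (2 * ρ) • (a + (1 / 2 : ℝ) • z) = y + ρ • z := by
      rw [ha, smul_add, smul_smul, smul_smul, mul_inv_cancel₀ (by positivity), one_smul,
        show 2 * ρ * (1 / 2) = ρ by ring]
      abel
    simp only [hg, hf, he]
    rcases le_or_gt 1 ‖z‖ with h | h
    · rw [radialWeight_eq_zero two_ne_zero h]
      have h4 : y + ρ • z ∈ U ∨ radialWeight 2 (a + (1 / 2 : ℝ) • z) = 0 := by
        by_cases h5 : 1 ≤ ‖a + (1 / 2 : ℝ) • z‖
        · exact Or.inr (radialWeight_eq_zero two_ne_zero h5)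
        · refine Or.inl (he ▸ hx ?_)
          rw [mem_closedBall, dist_self_add_left, norm_smul, Real.norm_of_nonneg (by positivity)]
          nlinarith
      rcases h4 with h4 | h4
      · have := mul_nonneg (h0 _ h4) (radialWeight_nonneg 2 (a + (1 / 2 : ℝ) • z))
        linarith
      · rw [h4]; simp
    · have h4 : y + ρ • z ∈ U := by
        refine hy ?_
        rw [mem_closedBall, dist_self_add_left, norm_smul, Real.norm_of_nonneg hρ.le]
        nlinarith
      have := mul_le_mul_of_nonneg_left (radialWeight_le_radialWeight_half ha4 z) (h0 _ h4)
      linarith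
  rw [integral_const_mul, hg', hfm, hgm] at hle
  have hA := integral_radialWeight_pos (m := m)
  have h6 : 49 / 256 * u y ≤ 2 ^ m * u x := by
    refine le_of_mul_le_mul_right ?_ hA
    linarith
  have h7 : (1 / 2 : ℝ) ^ m * 2 ^ m = 1 := by rw [← mul_pow]; norm_num
  calc 49 / 256 * (1 / 2) ^ m * u y = (1 / 2) ^ m * (49 / 256 * u y) := by ring
    _ ≤ (1 / 2) ^ m * (2 ^ m * u x) := by gcongr
    _ = u x := by rw [← mul_assoc, h7, one_mul]

theorem harnack_chain (hU : IsOpen U) (hu : IsHarmonicOn u U) (h0 : ∀ x ∈ U, 0 ≤ u x)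
    {p q : EuclideanSpace ℝ (Fin m)} {ρ : ℝ} (hρ : 0 < ρ)
    (hpq : ∀ x ∈ segment ℝ p q, closedBall x (2 * ρ) ⊆ U) {k : ℕ} (hk : 0 < k)
    (hd : ‖q - p‖ ≤ k * (ρ / 2)) : (49 / 256 * (1 / 2) ^ m) ^ k * u q ≤ u p := by
  set c : ℝ := 49 / 256 * (1 / 2) ^ m with hc
  have hk' : (0 : ℝ) < k := by exact_mod_cast hk
  have key : ∀ j : ℕ, j ≤ k → c ^ j * u (p + (j / k : ℝ) • (q - p)) ≤ u p := by
    intro j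
    induction j with
    | zero => intro _; simp
    | succ j ih =>
      intro hj
      have hjk : (j : ℝ) / k ≤ 1 := by
        rw [div_le_one hk']; exact_mod_cast (Nat.le_of_succ_le hj)
      have hmem : p + (j / k : ℝ) • (q - p) ∈ segment ℝ p q := by
        rw [segment_eq_image']
        exact ⟨_, ⟨by positivity, hjk⟩, rfl⟩
      have hstep := harnack_step hU hu h0 (y := p + ((j + 1 : ℕ) / k : ℝ) • (q - p)) hρ
        (hpq _ hmem) (by
          rw [add_sub_add_left_eq_sub, ← sub_smul, norm_smul, ← sub_div]
          push_cast
          rw [add_sub_cancel_left, Real.norm_of_nonneg (by positivity), one_div,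
            inv_mul_le_iff₀ hk']
          exact hd)
      refine le_trans ?_ (ih (Nat.le_of_succ_le hj))
      rw [pow_succ, mul_assoc]
      gcongr
  have := key k le_rfl
  rwa [div_self hk'.ne', one_smul, add_sub_cancel] at this

end Harnack

section MaximumPrinciple

open Metric Set Filter Topology

variable {m : ℕ}

theorem deriv_deriv_nonneg_of_isLocalMin {g : ℝ → ℝ} {s : ℝ} (hg : ContinuousAt g s)
    (hmin : IsLocalMin g s) : 0 ≤ deriv (deriv g) s := by
  by_contra! hneg
  have hmax := isLocalMax_of_deriv_deriv_neg hneg hmin.deriv_eq_zero hg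
  have hconst : g =ᶠ[𝓝 s] fun _ => g s := by
    filter_upwards [hmin, hmax] with t h1 h2 using le_antisymm h2 h1
  rw [hconst.deriv.deriv_eq] at hneg
  simp at hneg

theorem lapl_nonneg_of_isLocalMin {w : EuclideanSpace ℝ (Fin m) → ℝ}
    {p : EuclideanSpace ℝ (Fin m)} (hw : ContDiffAt ℝ 2 w p) (hmin : IsLocalMin w p) :
    0 ≤ lapl w p := by
  refine Finset.sum_nonneg fun i _ => ?_
  set e : EuclideanSpace ℝ (Fin m) := EuclideanSpace.single i 1
  have hline : ∀ s : ℝ, HasDerivAt (fun s : ℝ => p + s • e) e s := fun s => by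
    simpa using ((hasDerivAt_id s).smul_const e).const_add p
  have hp : p + (0 : ℝ) • e = p := by simp
  have htend : Tendsto (fun s : ℝ => p + s • e) (𝓝 0) (𝓝 p) := by
    have := (hline 0).continuousAt.tendsto
    rwa [hp] at this
  have hd1 : ∀ᶠ s : ℝ in 𝓝 0,
      deriv (fun s : ℝ => w (p + s • e)) s = fderiv ℝ w (p + s • e) e := by
    have : ∀ᶠ x in 𝓝 p, DifferentiableAt ℝ w x :=
      (hw.eventually (by simp)).mono fun x hx => hx.differentiableAt (by norm_num)
    filter_upwards [htend.eventually this] with s hs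
    exact (hs.hasFDerivAt.comp_hasDerivAt s (hline s)).deriv
  have hD : DifferentiableAt ℝ (fun y => fderiv ℝ w y e) p :=
    ((hw.fderiv_right (m := 1) (by norm_num)).clm_apply contDiffAt_const).differentiableAt
      (by norm_num)
  have hd2 : deriv (deriv fun s : ℝ => w (p + s • e)) 0 =
      fderiv ℝ (fun y => fderiv ℝ w y e) p e := by
    rw [EventuallyEq.deriv_eq hd1]
    have h1 : HasFDerivAt (fun y => fderiv ℝ w y e) (fderiv ℝ (fun y => fderiv ℝ w y e) p)
        (p + (0 : ℝ) • e) := by rw [hp]; exact hD.hasFDerivAt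
    exact (h1.comp_hasDerivAt (0 : ℝ) (hline 0)).deriv
  rw [← hd2]
  refine deriv_deriv_nonneg_of_isLocalMin ?_ ?_
  · refine ContinuousAt.comp (g := w) (f := fun s : ℝ => p + s • e) ?_ (hline 0).continuousAt
    rw [hp]; exact hw.continuousAt
  · have := htend.eventually hmin
    simpa [IsLocalMin, IsMinFilter] using this

theorem lapl_sub_const_mul {u q : EuclideanSpace ℝ (Fin m) → ℝ} {p : EuclideanSpace ℝ (Fin m)}
    (hu : ContDiffAt ℝ 2 u p) (hq : ContDiffAt ℝ 2 q p) (κ : ℝ) :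
    lapl (fun z => u z - κ * q z) p = lapl u p - κ * lapl q p := by
  unfold lapl
  rw [Finset.mul_sum, ← Finset.sum_sub_distrib]
  refine Finset.sum_congr rfl fun i _ => ?_
  set e : EuclideanSpace ℝ (Fin m) := EuclideanSpace.single i 1
  have hdu : DifferentiableAt ℝ (fun y => fderiv ℝ u y e) p :=
    ((hu.fderiv_right (m := 1) (by norm_num)).clm_apply contDiffAt_const).differentiableAt
      (by norm_num)
  have hdq : DifferentiableAt ℝ (fun y => fderiv ℝ q y e) p :=
    ((hq.fderiv_right (m := 1) (by norm_num)).clm_apply contDiffAt_const).differentiableAt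
      (by norm_num)
  have h1 : (fun y => fderiv ℝ (fun z => u z - κ * q z) y e) =ᶠ[𝓝 p]
      fun y => fderiv ℝ u y e - κ * fderiv ℝ q y e := by
    filter_upwards [hu.eventually (by simp), hq.eventually (by simp)] with y hy1 hy2
    have := (hy1.differentiableAt (by norm_num)).hasFDerivAt.sub
      ((hy2.differentiableAt (by norm_num)).hasFDerivAt.const_mul κ)
    erw [this.fderiv]
    simp
  rw [h1.fderiv_eq]
  have := hdu.hasFDerivAt.sub (hdq.hasFDerivAt.const_mul κ)
  erw [this.fderiv]
  simp

theorem lapl_sub_norm_sq_pow_sub (a b : ℝ) (k : ℕ) (c p : EuclideanSpace ℝ (Fin m)) :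
    lapl (fun z => (a - ‖z - c‖ ^ 2) ^ (k + 2) - b) p =
      (k + 2) * (a - ‖p - c‖ ^ 2) ^ k *
        (4 * (k + 1) * ‖p - c‖ ^ 2 - 2 * m * (a - ‖p - c‖ ^ 2)) := by
  have hs : ∀ z : EuclideanSpace ℝ (Fin m), HasFDerivAt (fun z => a - ‖z - c‖ ^ 2)
      (-((2 : ℝ) • innerSL ℝ (z - c))) z := by
    intro z
    have h1 := (hasStrictFDerivAt_norm_sq (z - c)).hasFDerivAt.comp z
      ((hasFDerivAt_id z).sub_const c)
    refine (h1.const_sub a).congr_fderiv ?_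
    ext v; simp
  have h1 : ∀ (z : EuclideanSpace ℝ (Fin m)) (i : Fin m),
      fderiv ℝ (fun z => (a - ‖z - c‖ ^ 2) ^ (k + 2) - b) z (EuclideanSpace.single i 1) =
        -2 * (k + 2) * ((a - ‖z - c‖ ^ 2) ^ (k + 1) * (z i - c i)) := by
    intro z i
    rw [(((hs z).pow (k + 2)).sub_const b).fderiv]
    simp [EuclideanSpace.inner_single_right]
    ring
  have h2 : ∀ i : Fin m, fderiv ℝ (fun z : EuclideanSpace ℝ (Fin m) =>
      -2 * (k + 2) * ((a - ‖z - c‖ ^ 2) ^ (k + 1) * (z i - c i))) p (EuclideanSpace.single i 1) =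
        4 * (k + 2) * (k + 1) * (a - ‖p - c‖ ^ 2) ^ k * (p - c) i ^ 2
          - 2 * (k + 2) * (a - ‖p - c‖ ^ 2) ^ (k + 1) := by
    intro i
    have h3 : HasFDerivAt (fun z : EuclideanSpace ℝ (Fin m) => z i - c i)
        (EuclideanSpace.proj i : EuclideanSpace ℝ (Fin m) →L[ℝ] ℝ) p :=
      (EuclideanSpace.proj i : EuclideanSpace ℝ (Fin m) →L[ℝ] ℝ).hasFDerivAt.sub_const (c i)
    have h4 := (((hs p).pow (k + 1)).mul h3).const_mul (-2 * ((k : ℝ) + 2))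
    refine (DFunLike.congr_fun h4.fderiv _).trans ?_
    simp [EuclideanSpace.inner_single_right]
    ring
  unfold lapl
  simp only [h1, h2]
  rw [Finset.sum_sub_distrib, ← Finset.mul_sum, Finset.sum_const, Finset.card_univ,
    Fintype.card_fin, EuclideanSpace.real_norm_sq_eq (p - c)]
  simp only [nsmul_eq_mul]
  ring

end MaximumPrinciple

section HalfBall

open Metric Set Filter Topology

variable {n : ℕ}

theorem continuous_last_coord :
    Continuous fun x : EuclideanSpace ℝ (Fin (n + 2)) => x (Fin.last (n + 1)) := by
  fun_prop

theorem isOpen_halfBall (r : ℝ) : IsOpen (halfBall n r) :=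
  (isOpen_lt continuous_norm continuous_const).inter
    (isOpen_lt continuous_const continuous_last_coord)

theorem norm_en : ‖en n‖ = 1 := by simp [en]

theorem en_last : en n (Fin.last (n + 1)) = 1 := by simp [en]

theorem last_coord_sub_le (x y : EuclideanSpace ℝ (Fin (n + 2))) :
    x (Fin.last (n + 1)) - y (Fin.last (n + 1)) ≤ ‖x - y‖ :=
  (le_abs_self _).trans (PiLp.norm_apply_le (x - y) (Fin.last (n + 1)))

theorem harnack_halfBall {u : EuclideanSpace ℝ (Fin (n + 2)) → ℝ}
    (hu : IsHarmonicOn u (halfBall n 1)) (h0 : ∀ x ∈ halfBall n 1, 0 ≤ u x)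
    (h1 : u ((2⁻¹ : ℝ) • en n) = 1) {x : EuclideanSpace ℝ (Fin (n + 2))} (hx : ‖x‖ ≤ 7 / 8)
    (hx' : 1 / 8 ≤ x (Fin.last (n + 1))) :
    (49 / 256 * (1 / 2) ^ (n + 2) : ℝ) ^ 60 ≤ u x := by
  have hq : ‖(2⁻¹ : ℝ) • en n‖ = 1 / 2 := by
    rw [norm_smul, norm_en, Real.norm_of_nonneg (by norm_num)]; norm_num
  have hq' : ((2⁻¹ : ℝ) • en n) (Fin.last (n + 1)) = 1 / 2 := by simp [en_last]
  have key := harnack_chain (isOpen_halfBall 1) hu h0 (p := x) (q := (2⁻¹ : ℝ) • en n)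
    (ρ := 1 / 20) (by norm_num) ?_ (k := 60) (by norm_num) ?_
  · rwa [h1, mul_one] at key
  · rintro _ ⟨a, b, ha, hb, hab, rfl⟩ z hz
    rw [mem_closedBall, dist_eq_norm] at hz
    set w := a • x + b • (2⁻¹ : ℝ) • en n with hw
    have hwn : ‖w‖ ≤ 7 / 8 := by
      refine (norm_add_le _ _).trans ?_
      rw [norm_smul a, norm_smul b, hq, Real.norm_of_nonneg ha, Real.norm_of_nonneg hb]
      nlinarith
    have hwl : 1 / 8 ≤ w (Fin.last (n + 1)) := by
      have : w (Fin.last (n + 1)) = a * x (Fin.last (n + 1)) + b * (1 / 2) := by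
        rw [← hq']; simp [hw]
      rw [this]; nlinarith
    have h2 := last_coord_sub_le w z
    rw [norm_sub_rev] at h2
    constructor
    · linarith [norm_le_norm_add_norm_sub w z, norm_sub_rev w z]
    · linarith
  · refine (norm_sub_le _ _).trans ?_
    rw [hq]; norm_num; linarith

/-- Comparison with the barrier `(1/8 - |z - c|²) ^ (k + 2) - (1/16) ^ (k + 2)` in an annulus. -/
theorem barrier_le_of_annulus {m k : ℕ} (hk : 7 * m < 2 * (k + 1))
    {u : EuclideanSpace ℝ (Fin m) → ℝ} {c : EuclideanSpace ℝ (Fin m)}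
    (hcont : ContinuousOn u (closedBall c (1 / 4))) (hu : IsHarmonicOn u (ball c (1 / 4)))
    (h0 : ∀ z ∈ closedBall c (1 / 4), 0 ≤ u z) {κ : ℝ} (hκ : 0 < κ)
    (h1 : ∀ z ∈ closedBall c (1 / 8), κ ≤ u z) {x : EuclideanSpace ℝ (Fin m)}
    (hx : 1 / 8 ≤ ‖x - c‖) (hx' : ‖x - c‖ ≤ 1 / 4) :
    κ * ((1 / 8 - ‖x - c‖ ^ 2) ^ (k + 2) - (1 / 16) ^ (k + 2)) ≤ u x := by
  set A : Set (EuclideanSpace ℝ (Fin m)) := closedBall c (1 / 4) \ ball c (1 / 8) with hA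
  set q : EuclideanSpace ℝ (Fin m) → ℝ :=
    fun z => (1 / 8 - ‖z - c‖ ^ 2) ^ (k + 2) - (1 / 16) ^ (k + 2) with hq
  have hqc : ContDiff ℝ 2 q :=
    ((contDiff_const.sub ((contDiff_id.sub contDiff_const).norm_sq ℝ)).pow _).sub contDiff_const
  have hAc : IsCompact A := (isCompact_closedBall c _).diff isOpen_ball
  have hxA : x ∈ A := by
    simp only [hA, Set.mem_sdiff, mem_closedBall, mem_ball, dist_eq_norm, not_lt]
    exact ⟨hx', hx⟩
  obtain ⟨p, hp, hmin⟩ := hAc.exists_isMinOn ⟨x, hxA⟩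
    (f := fun z => u z - κ * q z)
    ((hcont.mono sdiff_subset).sub (continuous_const.mul hqc.continuous).continuousOn)
  have hp1 : ‖p - c‖ ≤ 1 / 4 := by simpa [dist_eq_norm] using hp.1
  have hp2 : 1 / 8 ≤ ‖p - c‖ := by simpa [dist_eq_norm] using hp.2
  suffices 0 ≤ u p - κ * q p by
    have h := hmin hxA
    simp only [mem_ofPred_eq] at h
    linarith
  rcases hp1.eq_or_lt with he | hlt
  · have : q p = 0 := by simp only [hq, he]; norm_num
    rw [this, mul_zero, sub_zero]
    exact h0 p hp.1
  rcases hp2.eq_or_lt with he | hgt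
  · have h2 : q p ≤ 1 := by
      have h3 : (1 / 8 - ‖p - c‖ ^ 2) ^ (k + 2) ≤ 1 :=
        pow_le_one₀ (by rw [← he]; norm_num) (by rw [← he]; norm_num)
      have h4 : (0 : ℝ) ≤ (1 / 16) ^ (k + 2) := by positivity
      simp only [hq]; linarith
    have h3 := h1 p (by rw [mem_closedBall, dist_eq_norm, ← he])
    nlinarith
  · exfalso
    have hpb : p ∈ ball c (1 / 4) := by rwa [mem_ball, dist_eq_norm]
    have hpu : ContDiffAt ℝ 2 u p := hu.1.contDiffAt (isOpen_ball.mem_nhds hpb)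
    have hnhds : A ∈ 𝓝 p := by
      refine inter_mem (mem_of_superset (isOpen_ball.mem_nhds hpb) ball_subset_closedBall) ?_
      have : p ∈ (closedBall c (1 / 8))ᶜ := by simpa [dist_eq_norm] using hgt
      exact mem_of_superset (isClosed_closedBall.isOpen_compl.mem_nhds this)
        (compl_subset_compl.2 ball_subset_closedBall)
    have hlap := lapl_nonneg_of_isLocalMin
      (hpu.sub (contDiffAt_const.mul hqc.contDiffAt)) (hmin.isLocalMin hnhds)
    rw [lapl_sub_const_mul hpu hqc.contDiffAt, hu.2 p hpb, lapl_sub_norm_sq_pow_sub] at hlap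
    have hs : ‖p - c‖ ^ 2 < 1 / 16 := by nlinarith [norm_nonneg (p - c)]
    have hs' : 1 / 64 < ‖p - c‖ ^ 2 := by nlinarith
    have hk' : (7 * m : ℝ) < 2 * (k + 1) := by exact_mod_cast hk
    have hm : (0 : ℝ) ≤ m := by positivity
    have h5 : 0 < 4 * (k + 1) * ‖p - c‖ ^ 2 - 2 * m * (1 / 8 - ‖p - c‖ ^ 2) := by
      nlinarith
    have h6 : 0 < (1 / 8 - ‖p - c‖ ^ 2) ^ k := pow_pos (by linarith) k
    have h7 : 0 < κ * ((k + 2) * (1 / 8 - ‖p - c‖ ^ 2) ^ k *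
        (4 * (k + 1) * ‖p - c‖ ^ 2 - 2 * m * (1 / 8 - ‖p - c‖ ^ 2))) := by positivity
    linarith

theorem linear_le_barrier (k : ℕ) {t : ℝ} (ht : 0 ≤ t) (ht' : t ≤ 1 / 8) :
    (1 / 16) ^ (k + 2) * t ≤ (1 / 8 - (1 / 4 - t) ^ 2) ^ (k + 2) - (1 / 16) ^ (k + 2) := by
  have h1 : (1 / 8 - (1 / 4 - t) ^ 2) ^ (k + 2) =
      (1 / 16) ^ (k + 2) * (1 + (8 * t - 16 * t ^ 2)) ^ (k + 2) := by
    rw [← mul_pow]; ring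
  have h2 : 0 ≤ 8 * t - 16 * t ^ 2 := by nlinarith
  have h3 := one_add_mul_le_pow (a := 8 * t - 16 * t ^ 2) (by linarith) (k + 2)
  have h4 : t ≤ ((k + 2 : ℕ) : ℝ) * (8 * t - 16 * t ^ 2) := by
    push_cast
    have : (0 : ℝ) ≤ k := by positivity
    nlinarith
  rw [h1]
  have h5 : (0 : ℝ) < (1 / 16) ^ (k + 2) := by positivity
  nlinarith

end HalfBall

theorem hopf_lemma_half_ball (n : ℕ) :
    ∃ C : ℝ, 0 < C ∧
      ∀ u : EuclideanSpace ℝ (Fin (n + 2)) → ℝ,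
        ContinuousOn u (halfBall n 1 ∪ flatT n 1) →
        IsHarmonicOn u (halfBall n 1) →
        (∀ x ∈ halfBall n 1, 0 ≤ u x) →
        (∀ x ∈ flatT n 1, u x = 0) →
        u ((2⁻¹ : ℝ) • en n) = 1 →
        ∀ x ∈ halfBall n (1 / 2), C * x (Fin.last (n + 1)) ≤ u x := by
  set κ : ℝ := (49 / 256 * (1 / 2) ^ (n + 2)) ^ 60 with hκdef
  have hκ : 0 < κ := by positivity
  set k : ℕ := 4 * (n + 2) with hk
  have hb : (0 : ℝ) < (1 / 16) ^ (k + 2) := by positivity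
  have hb1 : ((1 / 16) ^ (k + 2) : ℝ) ≤ 1 := pow_le_one₀ (by norm_num) (by norm_num)
  refine ⟨κ * (1 / 16) ^ (k + 2), by positivity, fun u hcont hu h0 hT h1 x hx => ?_⟩
  have hxn : ‖x‖ < 1 / 2 := hx.1
  have hxpos : 0 < x (Fin.last (n + 1)) := hx.2
  have hxle := (le_abs_self _).trans (PiLp.norm_apply_le x (Fin.last (n + 1)))
  set t : ℝ := x (Fin.last (n + 1)) with ht
  rcases le_or_gt (1 / 8) t with h8 | h8
  · have h2 := harnack_halfBall hu h0 h1 (x := x) (by linarith) h8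
    refine le_trans ?_ h2
    rw [mul_assoc]
    exact mul_le_of_le_one_right hκ.le (mul_le_one₀ hb1 hxpos.le (by linarith))
  · set c : EuclideanSpace ℝ (Fin (n + 2)) := x + (1 / 4 - t) • en n with hc
    have hcl : c (Fin.last (n + 1)) = 1 / 4 := by simp [hc, en_last, ht]
    have hxc : ‖x - c‖ = 1 / 4 - t := by
      rw [hc, sub_add_cancel_left, norm_neg, norm_smul, norm_en, mul_one,
        Real.norm_of_nonneg (by linarith)]
    have hcn : ‖c‖ < 3 / 4 := by
      have := norm_le_norm_add_norm_sub x c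
      linarith
    have hnorm : ∀ z : EuclideanSpace ℝ (Fin (n + 2)), ‖z‖ ≤ ‖c‖ + ‖z - c‖ := fun z => by
      have := norm_le_norm_add_norm_sub c z
      rwa [norm_sub_rev] at this
    have hlast : ∀ z : EuclideanSpace ℝ (Fin (n + 2)),
        1 / 4 - ‖z - c‖ ≤ z (Fin.last (n + 1)) := fun z => by
      have := last_coord_sub_le c z
      rw [norm_sub_rev] at this
      linarith
    have hball : Metric.ball c (1 / 4) ⊆ halfBall n 1 := fun z hz => by
      rw [Metric.mem_ball, dist_eq_norm] at hz
      exact ⟨by linarith [hnorm z], by linarith [hlast z]⟩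
    have hclosed : Metric.closedBall c (1 / 4) ⊆ halfBall n 1 ∪ flatT n 1 := fun z hz => by
      rw [Metric.mem_closedBall, dist_eq_norm] at hz
      have hz1 : ‖z‖ < 1 := by linarith [hnorm z]
      have hz2 : 0 ≤ z (Fin.last (n + 1)) := by linarith [hlast z]
      rcases hz2.eq_or_lt with h | h
      · exact Or.inr ⟨hz1, h.symm⟩
      · exact Or.inl ⟨hz1, h⟩
    have hbar := barrier_le_of_annulus (k := k) (by omega) (hcont.mono hclosed)
      ⟨hu.1.mono hball, fun z hz => hu.2 z (hball hz)⟩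
      (fun z hz => (hclosed hz).elim (h0 z) fun h => (hT z h).ge) hκ
      (fun z hz => by
        rw [Metric.mem_closedBall, dist_eq_norm] at hz
        exact harnack_halfBall hu h0 h1 (by linarith [hnorm z]) (by linarith [hlast z]))
      (x := x) (by linarith) (by linarith)
    rw [hxc] at hbar
    refine le_trans ?_ hbar
    rw [mul_assoc]
    exact mul_le_mul_of_nonneg_left (linear_le_barrier k hxpos.le h8.le) hκ.le
end
end

section
/- Let u be continuous on the closed half-space {x ∈ ℝⁿ : xₙ ≥ 0}, harmonic on the open half-space {xₙ > 0}, and u = 0 on the hyperplane {xₙ = 0}. Suppose u(x) = O(xₙ) as |x| → ∞, i.e. there exist M > 0 and R₀ > 0 such that |u(x)| ≤ M·xₙ for all x with xₙ ≥ 0 and |x| ≥ R₀. Then u(x) = u(eₙ)·xₙ for every x with xₙ ≥ 0. -/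
noncomputable section

open Filter Topology

/-- `g` is differentiable near `x` and its derivative has derivative `c` at `x`. -/
def HasSecondDerivAt (g : ℝ → ℝ) (c x : ℝ) : Prop :=
  ∃ g' : ℝ → ℝ, (∀ᶠ y in 𝓝 x, HasDerivAt g (g' y) y) ∧ HasDerivAt g' c x

namespace HasSecondDerivAt

variable {f g : ℝ → ℝ} {b c x : ℝ}

theorem congr (hf : HasSecondDerivAt f c x) (hfg : ∀ y, f y = g y) : HasSecondDerivAt g c x :=
  (funext hfg : f = g) ▸ hf

theorem unique (hf : HasSecondDerivAt f b x) (hg : HasSecondDerivAt f c x) : b = c := by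
  obtain ⟨f', hf, hf'⟩ := hf
  obtain ⟨g', hg, hg'⟩ := hg
  refine hf'.unique (hg'.congr_of_eventuallyEq ?_)
  filter_upwards [hf, hg] with y h1 h2 using h1.unique h2

theorem const (a x : ℝ) : HasSecondDerivAt (fun _ => a) 0 x :=
  ⟨fun _ => 0, Eventually.of_forall fun y => hasDerivAt_const y a, hasDerivAt_const x 0⟩

theorem shift (hf : HasSecondDerivAt (fun t => f (x + t)) c 0) : HasSecondDerivAt f c x := by
  obtain ⟨f', hf, hf'⟩ := hf
  refine ⟨fun y => f' (y - x), ?_, ?_⟩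
  · have : Tendsto (fun y => y - x) (𝓝 x) (𝓝 0) := by
      simpa using (continuous_sub_right x).tendsto x
    filter_upwards [this.eventually hf] with y h
    simpa using h.comp_sub_const y x
  · exact HasDerivAt.comp_sub_const x x (by rwa [sub_self])

theorem add (hf : HasSecondDerivAt f b x) (hg : HasSecondDerivAt g c x) :
    HasSecondDerivAt (fun y => f y + g y) (b + c) x := by
  obtain ⟨f', hf, hf'⟩ := hf
  obtain ⟨g', hg, hg'⟩ := hg
  exact ⟨fun y => f' y + g' y, by filter_upwards [hf, hg] with y h1 h2 using h1.add h2, hf'.add hg'⟩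

theorem const_mul (a : ℝ) (hf : HasSecondDerivAt f b x) :
    HasSecondDerivAt (fun y => a * f y) (a * b) x := by
  obtain ⟨f', hf, hf'⟩ := hf
  exact ⟨fun y => a * f' y, by filter_upwards [hf] with y h using h.const_mul a, hf'.const_mul a⟩

theorem sub (hf : HasSecondDerivAt f b x) (hg : HasSecondDerivAt g c x) :
    HasSecondDerivAt (fun y => f y - g y) (b - c) x := by
  obtain ⟨f', hf, hf'⟩ := hf
  obtain ⟨g', hg, hg'⟩ := hg
  exact ⟨fun y => f' y - g' y, by filter_upwards [hf, hg] with y h1 h2 using h1.sub h2, hf'.sub hg'⟩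

theorem comp_neg (hf : HasSecondDerivAt f b 0) : HasSecondDerivAt (fun y => f (-y)) b 0 := by
  obtain ⟨f', hf, hf'⟩ := hf
  have key : ∀ {φ : ℝ → ℝ} {d y : ℝ}, HasDerivAt φ d (-y) → HasDerivAt (fun y => φ (-y)) (-d) y := by
    intro φ d y h
    have := HasDerivAt.comp y h (hasDerivAt_neg y)
    rwa [mul_neg_one] at this
  refine ⟨fun y => -f' (-y), ?_, ?_⟩
  · have : Tendsto (fun y : ℝ => -y) (𝓝 0) (𝓝 0) := by
      simpa using (continuous_neg (G := ℝ)).tendsto 0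
    filter_upwards [this.eventually hf] with y h using key h
  · have h0 : HasDerivAt f' b (-0) := by simpa using hf'
    exact (key h0).neg.congr_deriv (neg_neg b)

theorem nonpos_of_isLocalMax (hf : HasSecondDerivAt f c x) (hmax : IsLocalMax f x) : c ≤ 0 := by
  by_contra! hc
  obtain ⟨f', hf, hf'⟩ := hf
  have hderiv : deriv f =ᶠ[𝓝 x] f' := by filter_upwards [hf] with y h using h.deriv
  have hdd : deriv (deriv f) x = c := by rw [hderiv.deriv_eq, hf'.deriv]
  have hmin : IsLocalMin f x := isLocalMin_of_deriv_deriv_pos (by rwa [hdd])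
    hmax.deriv_eq_zero hf.self_of_nhds.continuousAt
  have hconst : f =ᶠ[𝓝 x] fun _ => f x := by
    filter_upwards [hmax, hmin] with y h1 h2 using le_antisymm h1 h2
  have : deriv (deriv f) x = 0 := by
    rw [hconst.deriv.deriv_eq]
    simp
  linarith

end HasSecondDerivAt

theorem ContDiffAt.hasSecondDerivAt_line {E : Type*} [NormedAddCommGroup E] [NormedSpace ℝ E]
    {u : E → ℝ} {x : E} (hu : ContDiffAt ℝ 2 u x) (v : E) :
    HasSecondDerivAt (fun t : ℝ => u (x + t • v)) (fderiv ℝ (fun y => fderiv ℝ u y v) x v) 0 := by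
  have hline : ∀ t : ℝ, HasDerivAt (fun t : ℝ => x + t • v) v t := fun t => by
    simpa using ((hasDerivAt_id t).smul_const v).const_add x
  refine ⟨fun t => fderiv ℝ u (x + t • v) v, ?_, ?_⟩
  · have h1 : ∀ᶠ y in 𝓝 x, DifferentiableAt ℝ u y := by
      filter_upwards [hu.eventually (by simp)] with y hy using hy.differentiableAt (by simp)
    have h2 : Tendsto (fun t : ℝ => x + t • v) (𝓝 0) (𝓝 x) := by
      simpa using (hline 0).continuousAt.tendsto
    filter_upwards [h2.eventually h1] with t ht
    exact ht.hasFDerivAt.comp_hasDerivAt t (hline t)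
  · have h1 : DifferentiableAt ℝ (fun y => fderiv ℝ u y v) (x + (0 : ℝ) • v) := by
      have : ContDiffAt ℝ 1 (fderiv ℝ u) x := hu.fderiv_right (by norm_num)
      simpa using (this.differentiableAt (by simp)).clm_apply (differentiableAt_const v)
    have := h1.hasFDerivAt.comp_hasDerivAt (0 : ℝ) (hline 0)
    rwa [zero_smul, add_zero] at this

/-- A superharmonic function of `s = p + q`, `t = p - q` that is nonnegative for `|t| ≤ s`. -/
def cornerBarrier (s t : ℝ) : ℝ := s ^ (3 / 2 : ℝ) - 1 / 2 * (t ^ 2 * s ^ (-1 / 2 : ℝ))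

theorem cornerBarrier_nonneg {s t : ℝ} (hs : 0 < s) (ht : |t| ≤ s) : 0 ≤ cornerBarrier s t := by
  have h1 : s ^ (3 / 2 : ℝ) = s ^ 2 * s ^ (-1 / 2 : ℝ) := by
    rw [← Real.rpow_natCast, ← Real.rpow_add hs]
    norm_num
  have h2 : t ^ 2 ≤ s ^ 2 := sq_le_sq' (abs_le.mp ht).1 (abs_le.mp ht).2
  have h3 : 0 ≤ s ^ (-1 / 2 : ℝ) := by positivity
  rw [cornerBarrier, h1]
  nlinarith [mul_le_mul_of_nonneg_right h2 h3, mul_nonneg (sq_nonneg s) h3]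

theorem cornerBarrier_hasSecondDerivAt {s t e : ℝ} (hs : 0 < s) (he : e ^ 2 = 1) :
    HasSecondDerivAt (fun y => cornerBarrier (s + y) (t + e * y))
      (-1 / 4 * s ^ (-1 / 2 : ℝ) + e * t * s ^ (-3 / 2 : ℝ) - 3 / 8 * t ^ 2 * s ^ (-5 / 2 : ℝ))
      0 := by
  have hpow : ∀ (a : ℝ) {y : ℝ}, 0 < s + y →
      HasDerivAt (fun y => (s + y) ^ a) (a * (s + y) ^ (a - 1)) y := fun a y hy => by
    simpa using ((hasDerivAt_id y).const_add s).rpow_const (p := a) (Or.inl hy.ne')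
  have hlin : ∀ y : ℝ, HasDerivAt (fun y => t + e * y) e y := fun y => by
    simpa using ((hasDerivAt_id y).const_mul e).const_add t
  refine ⟨fun y => 3 / 2 * (s + y) ^ (1 / 2 : ℝ) - e * ((t + e * y) * (s + y) ^ (-1 / 2 : ℝ))
    + 1 / 4 * ((t + e * y) ^ 2 * (s + y) ^ (-3 / 2 : ℝ)), ?_, ?_⟩
  · filter_upwards [Ioi_mem_nhds (neg_lt_zero.mpr hs)] with y hy
    have hy : 0 < s + y := by simpa [neg_lt_iff_pos_add'] using hy
    have := (hpow (3 / 2) hy).sub ((((hlin y).pow 2).mul (hpow (-1 / 2) hy)).const_mul (1 / 2))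
    refine this.congr_deriv ?_
    norm_num
    ring
  · have h0 : 0 < s + (0 : ℝ) := by simpa
    have := (((hpow (1 / 2) h0).const_mul (3 / 2)).sub
      (((hlin 0).mul (hpow (-1 / 2) h0)).const_mul e)).add
      ((((hlin 0).pow 2).mul (hpow (-3 / 2) h0)).const_mul (1 / 4))
    refine this.congr_deriv ?_
    norm_num
    linear_combination (-(1 : ℝ) * s ^ (-(1 / 2) : ℝ)) * he

theorem continuousOn_cornerBarrier_comp {X : Type*} [TopologicalSpace X] {s t : X → ℝ} {C : Set X}
    (hs : ContinuousOn s C) (ht : ContinuousOn t C) (hpos : ∀ x ∈ C, 0 < s x) :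
    ContinuousOn (fun x => cornerBarrier (s x) (t x)) C := by
  unfold cornerBarrier
  exact (hs.rpow_const fun x hx => Or.inl (hpos x hx).ne').sub
    (continuousOn_const.mul ((ht.pow 2).mul (hs.rpow_const fun x hx => Or.inl (hpos x hx).ne')))

section QuarterSpace

variable {m : ℕ}

theorem norm_add_smul_single_sq (x : EuclideanSpace ℝ (Fin m)) (k : Fin m) (t : ℝ) :
    ‖x + t • EuclideanSpace.single k (1 : ℝ)‖ ^ 2 = ‖x‖ ^ 2 + 2 * t * x k + t ^ 2 := by
  rw [norm_add_sq_real, inner_smul_right, EuclideanSpace.inner_single_right, norm_smul]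
  simp
  ring

theorem add_smul_single_apply (x : EuclideanSpace ℝ (Fin m)) (j k : Fin m) (t : ℝ) :
    (x + t • EuclideanSpace.single k (1 : ℝ)) j = x j + if j = k then t else 0 := by
  simp

/-- The comparison function on the quarter ball of radius `R`. -/
def quarterBarrier (i l : Fin m) (R : ℝ) (x : EuclideanSpace ℝ (Fin m)) : ℝ :=
  1 / R * ‖x‖ ^ 2 + (8 * m + 4) / √R * cornerBarrier (x i + x l + 1) (x i - x l)

theorem cornerBarrier_coord_nonneg {i l : Fin m} {x : EuclideanSpace ℝ (Fin m)}
    (hi : 0 ≤ x i) (hl : 0 ≤ x l) : 0 ≤ cornerBarrier (x i + x l + 1) (x i - x l) :=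
  cornerBarrier_nonneg (by linarith) (abs_le.mpr ⟨by linarith, by linarith⟩)

theorem exists_quarterBarrier_hasSecondDerivAt {i l : Fin m} (hil : i ≠ l) {R : ℝ} (hR : 1 ≤ R)
    {x : EuclideanSpace ℝ (Fin m)} (hi : 0 ≤ x i) (hl : 0 ≤ x l) (hx : ‖x‖ ≤ R) :
    ∃ b : Fin m → ℝ, (∀ k, HasSecondDerivAt
      (fun t : ℝ => quarterBarrier i l R (x + t • EuclideanSpace.single k (1 : ℝ))) (b k) 0) ∧
      ∑ k, b k < 0 := by
  set s := x i + x l + 1 with hs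
  set t := x i - x l with ht
  have hs0 : 0 < s := by linarith
  have hR0 : 0 < R := by linarith
  set c : ℝ → ℝ := fun e =>
    -1 / 4 * s ^ (-1 / 2 : ℝ) + e * t * s ^ (-3 / 2 : ℝ) - 3 / 8 * t ^ 2 * s ^ (-5 / 2 : ℝ) with hc
  set A : ℝ := (8 * m + 4) / √R with hA
  refine ⟨fun k => 1 / R * 2 + A * ((if k = i then c 1 else 0) + if k = l then c (-1) else 0),
    fun k => ?_, ?_⟩
  · unfold quarterBarrier
    refine HasSecondDerivAt.add (HasSecondDerivAt.const_mul _ ?_) (HasSecondDerivAt.const_mul _ ?_)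
    · simp only [norm_add_smul_single_sq]
      refine ⟨fun y => 2 * x k + 2 * y, Eventually.of_forall fun y => ?_, ?_⟩
      · have := ((((hasDerivAt_id y).const_mul 2).mul_const (x k)).const_add (‖x‖ ^ 2)).add
          ((hasDerivAt_id y).pow 2)
        refine this.congr_deriv ?_
        simp
      · simpa using ((hasDerivAt_id (0 : ℝ)).const_mul 2).const_add (2 * x k)
    · simp only [add_smul_single_apply]
      by_cases hki : k = i
      · subst hki
        convert cornerBarrier_hasSecondDerivAt (t := t) hs0 (e := 1) (by norm_num) using 1
        · ext y
          simp only [if_true, if_neg hil.symm]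
          congr 1 <;> simp only [hs, ht] <;> ring
        · simp [hc, hil]
      · by_cases hkl : k = l
        · subst hkl
          convert cornerBarrier_hasSecondDerivAt (t := t) hs0 (e := -1) (by norm_num) using 1
          · ext y
            simp only [if_true, if_neg hil]
            congr 1 <;> simp only [hs, ht] <;> ring
          · simp [hc, hki]
        · simp only [if_neg (Ne.symm hki), if_neg (Ne.symm hkl), if_neg hki, if_neg hkl]
          simpa using HasSecondDerivAt.const _ 0
  · have hsum : c 1 + c (-1) ≤ -1 / 2 * s ^ (-1 / 2 : ℝ) := by
      have : 0 ≤ t ^ 2 * s ^ (-5 / 2 : ℝ) := by positivity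
      simp only [hc]
      linarith
    have hcoord : ∀ j, x j ≤ R := fun j =>
      (le_abs_self _).trans ((PiLp.norm_apply_le x j).trans hx)
    have hsR : s ≤ 4 * R := by linarith [hcoord i, hcoord l]
    have hsqrt : √s ≤ 2 * √R := by
      calc √s ≤ √(2 ^ 2 * R) := Real.sqrt_le_sqrt (by linarith)
        _ = 2 * √R := by rw [Real.sqrt_mul (by norm_num), Real.sqrt_sq (by norm_num)]
    have hinv : s ^ (-1 / 2 : ℝ) = (√s)⁻¹ := by
      rw [Real.sqrt_eq_rpow, ← Real.rpow_neg hs0.le]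
      norm_num
    have hlow : (2 * √R)⁻¹ ≤ s ^ (-1 / 2 : ℝ) := by
      rw [hinv]
      exact inv_anti₀ (Real.sqrt_pos.mpr hs0) hsqrt
    have hA0 : 0 < A := by positivity
    have hAR : A * (2 * √R)⁻¹ = (4 * m + 2) / R := by
      have h1 : √R ≠ 0 := (Real.sqrt_pos.mpr hR0).ne'
      have h2 : √R ^ 2 = R := Real.sq_sqrt hR0.le
      rw [hA]
      field_simp
      rw [h2]
      ring
    have htot : ∑ k : Fin m, (1 / R * 2 +
        A * ((if k = i then c 1 else 0) + if k = l then c (-1) else 0))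
        = 2 * m / R + A * (c 1 + c (-1)) := by
      rw [Finset.sum_add_distrib, ← Finset.mul_sum, ← Finset.mul_sum, Finset.sum_add_distrib]
      simp
      ring
    rw [htot]
    have h3 : A * (c 1 + c (-1)) ≤ -1 / 2 * ((4 * m + 2) / R) := by
      rw [← hAR]
      nlinarith [mul_le_mul_of_nonneg_left hsum hA0.le, mul_le_mul_of_nonneg_left hlow hA0.le]
    have h4 : 2 * m / R + -1 / 2 * ((4 * m + 2) / R) = -(1 / R) := by
      field_simp
      ring
    have : 0 < 1 / R := by positivity
    linarith

/-- A Phragmén–Lindelöf principle for linear growth in the quarter space. -/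
theorem nonpos_of_quarterSpace_linear_growth {i l : Fin m} (hil : i ≠ l)
    {w : EuclideanSpace ℝ (Fin m) → ℝ} (hcont : ContinuousOn w {x | 0 ≤ x i ∧ 0 ≤ x l})
    (hharm : ∀ x, 0 < x i → 0 < x l → ∃ d : Fin m → ℝ, (∀ k, HasSecondDerivAt
      (fun t : ℝ => w (x + t • EuclideanSpace.single k (1 : ℝ))) (d k) 0) ∧ ∑ k, d k = 0)
    (hi : ∀ x, x i = 0 → 0 ≤ x l → w x ≤ 0) (hl : ∀ x, x l = 0 → w x ≤ 0)
    {M R₀ : ℝ} (hM : 0 < M)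
    (hgrowth : ∀ x, 0 ≤ x i → 0 ≤ x l → R₀ ≤ ‖x‖ → w x ≤ M * x l)
    {x : EuclideanSpace ℝ (Fin m)} (hxi : 0 ≤ x i) (hxl : 0 ≤ x l) : w x ≤ 0 := by
  have hci : Continuous fun y : EuclideanSpace ℝ (Fin m) => y i := by fun_prop
  have hcl : Continuous fun y : EuclideanSpace ℝ (Fin m) => y l := by fun_prop
  have key : ∀ R, 1 ≤ R → R₀ ≤ R → ‖x‖ ≤ R → w x ≤ M * quarterBarrier i l R x := by
    intro R hR1 hR0 hxR
    have hRpos : 0 < R := by linarith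
    set C : Set (EuclideanSpace ℝ (Fin m)) :=
      Metric.closedBall 0 R ∩ {y | 0 ≤ y i ∧ 0 ≤ y l} with hC
    have hCc : IsCompact C := (isCompact_closedBall _ _).inter_right
      ((isClosed_le continuous_const hci).inter (isClosed_le continuous_const hcl))
    have hB : ContinuousOn (quarterBarrier i l R) C := by
      unfold quarterBarrier
      refine ContinuousOn.add (by fun_prop) (continuousOn_const.mul
        (continuousOn_cornerBarrier_comp (by fun_prop) (by fun_prop) ?_))
      rintro y ⟨-, h1, h2⟩
      linarith
    have hBge : ∀ y ∈ C, 1 / R * ‖y‖ ^ 2 ≤ quarterBarrier i l R y := by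
      rintro y ⟨-, h1, h2⟩
      have := cornerBarrier_coord_nonneg h1 h2
      rw [quarterBarrier]
      have : 0 ≤ (8 * m + 4) / √R * cornerBarrier (y i + y l + 1) (y i - y l) := by positivity
      linarith
    have hxC : x ∈ C := ⟨by simpa using hxR, hxi, hxl⟩
    obtain ⟨z, hz, hmax⟩ := hCc.exists_isMaxOn ⟨x, hxC⟩
      ((hcont.mono Set.inter_subset_right).sub (continuousOn_const (c := M) |>.mul hB))
    have hle := hmax hxC
    suffices hz0 : w z - M * quarterBarrier i l R z ≤ 0 by
      have : w x - M * quarterBarrier i l R x ≤ w z - M * quarterBarrier i l R z := hle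
      linarith
    by_contra! hpos
    have hBz := hBge z hz
    obtain ⟨hzR, hzi, hzl⟩ := hz
    have hzR : ‖z‖ ≤ R := by simpa using hzR
    have hB0 : 0 ≤ M * quarterBarrier i l R z :=
      mul_nonneg hM.le (le_trans (by positivity) hBz)
    have hzi' : 0 < z i := lt_of_le_of_ne hzi fun h => by linarith [hi z h.symm hzl]
    have hzl' : 0 < z l := lt_of_le_of_ne hzl fun h => by linarith [hl z h.symm]
    have hzR' : ‖z‖ < R := by
      refine lt_of_le_of_ne hzR fun h => ?_
      have h1 := hgrowth z hzi hzl (by rw [h]; exact hR0)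
      have h2 : z l ≤ R := (le_abs_self _).trans ((PiLp.norm_apply_le z l).trans hzR)
      rw [h, show 1 / R * R ^ 2 = R by field_simp] at hBz
      nlinarith [mul_le_mul_of_nonneg_left (h2.trans hBz) hM.le]
    have hnhds : C ∈ 𝓝 z := by
      filter_upwards [continuous_norm.continuousAt.eventually_lt_const hzR',
        hci.continuousAt.eventually_const_lt hzi', hcl.continuousAt.eventually_const_lt hzl']
        with y h1 h2 h3
      exact ⟨by simpa using h1.le, h2.le, h3.le⟩
    obtain ⟨d, hd, hd0⟩ := hharm z hzi' hzl'
    obtain ⟨b, hb, hb0⟩ := exists_quarterBarrier_hasSecondDerivAt hil hR1 hzi hzl hzR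
    have hk : ∀ k, d k - M * b k ≤ 0 := fun k => by
      have hk := (hd k).sub ((hb k).const_mul M)
      apply hk.nonpos_of_isLocalMax
      have hline : Tendsto (fun t : ℝ => z + t • EuclideanSpace.single k (1 : ℝ)) (𝓝 0) (𝓝 z) := by
        have : Continuous fun t : ℝ => z + t • EuclideanSpace.single k (1 : ℝ) := by fun_prop
        simpa using this.tendsto 0
      filter_upwards [hline.eventually hnhds] with t ht
      simpa using hmax ht
    have hsum := Finset.sum_nonpos fun k (_ : k ∈ Finset.univ) => hk k
    rw [Finset.sum_sub_distrib, ← Finset.mul_sum, hd0] at hsum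
    nlinarith
  have hlim : Tendsto (fun R => M * quarterBarrier i l R x) atTop (𝓝 0) := by
    have h1 : Tendsto (fun R : ℝ => 1 / R) atTop (𝓝 0) := by
      simpa using tendsto_inv_atTop_zero (𝕜 := ℝ)
    have h2 : Tendsto (fun R : ℝ => (8 * (m : ℝ) + 4) / √R) atTop (𝓝 0) :=
      Real.tendsto_sqrt_atTop.const_div_atTop _
    simpa [quarterBarrier] using ((h1.mul_const (‖x‖ ^ 2)).add (h2.mul_const
      (cornerBarrier (x i + x l + 1) (x i - x l)))).const_mul M
  refine ge_of_tendsto hlim ?_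
  filter_upwards [eventually_ge_atTop 1, eventually_ge_atTop R₀, eventually_ge_atTop ‖x‖]
    with R h1 h2 h3 using key R h1 h2 h3

end QuarterSpace

section HalfSpace

variable {m : ℕ} {u : EuclideanSpace ℝ (Fin m) → ℝ} {l : Fin m}

theorem IsHarmonicOn.hasSecondDerivAt_line {U : Set (EuclideanSpace ℝ (Fin m))}
    (hu : IsHarmonicOn u U) (hU : IsOpen U) {x : EuclideanSpace ℝ (Fin m)} (hx : x ∈ U) :
    ∃ d : Fin m → ℝ, (∀ k, HasSecondDerivAt
      (fun t : ℝ => u (x + t • EuclideanSpace.single k (1 : ℝ))) (d k) 0) ∧ ∑ k, d k = 0 :=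
  ⟨_, fun _ => (hu.1.contDiffAt (hU.mem_nhds hx)).hasSecondDerivAt_line _, hu.2 x hx⟩

theorem isOpen_halfSpace (l : Fin m) : IsOpen {x : EuclideanSpace ℝ (Fin m) | 0 < x l} :=
  isOpen_lt continuous_const (by fun_prop)

/-- Comparison of `u` with its reflection across the hyperplane `{xᵢ = a}`. -/
theorem le_reflection_of_linear_growth {i : Fin m} (hil : i ≠ l)
    (hcont : ContinuousOn u {x | 0 ≤ x l})
    (hharm : ∀ x, 0 < x l → ∃ d : Fin m → ℝ, (∀ k, HasSecondDerivAt
      (fun t : ℝ => u (x + t • EuclideanSpace.single k (1 : ℝ))) (d k) 0) ∧ ∑ k, d k = 0)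
    (hbd : ∀ x, x l = 0 → u x = 0) {M R₀ : ℝ} (hM : 0 < M)
    (hgrowth : ∀ x, 0 ≤ x l → R₀ ≤ ‖x‖ → |u x| ≤ M * x l)
    (a : ℝ) {x : EuclideanSpace ℝ (Fin m)} (hxi : 0 ≤ x i) (hxl : 0 ≤ x l) :
    u (x + a • EuclideanSpace.single i (1 : ℝ)) ≤
      u (x + (-2 * x i) • EuclideanSpace.single i (1 : ℝ) + a • EuclideanSpace.single i (1 : ℝ)) := by
  set e : EuclideanSpace ℝ (Fin m) := EuclideanSpace.single i (1 : ℝ) with he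
  have hl_add : ∀ (y : EuclideanSpace ℝ (Fin m)) (t : ℝ), (y + t • e) l = y l := fun y t => by
    simp [he, hil.symm]
  have hc1 : Continuous fun y : EuclideanSpace ℝ (Fin m) => y + a • e := by fun_prop
  have hc2 : Continuous fun y : EuclideanSpace ℝ (Fin m) => y + (-2 * y i) • e + a • e := by fun_prop
  rw [← sub_nonpos]
  refine nonpos_of_quarterSpace_linear_growth (R₀ := R₀ + |a|) (M := 2 * M) hil
    (w := fun y => u (y + a • e) - u (y + (-2 * y i) • e + a • e)) ?_ ?_ ?_ ?_ (by linarith) ?_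
    hxi hxl
  · refine (hcont.comp hc1.continuousOn ?_).sub (hcont.comp hc2.continuousOn ?_)
    · rintro y ⟨-, hy⟩
      simpa only [Set.mem_ofPred_eq, hl_add] using hy
    · rintro y ⟨-, hy⟩
      simpa only [Set.mem_ofPred_eq, hl_add] using hy
  · intro y _ hyl
    obtain ⟨d, hd, hd0⟩ := hharm (y + a • e) (by rwa [hl_add])
    obtain ⟨b, hb, hb0⟩ := hharm (y + (-2 * y i) • e + a • e) (by rwa [hl_add, hl_add])
    refine ⟨fun k => d k - b k, fun k => ?_, by rw [Finset.sum_sub_distrib, hd0, hb0, sub_zero]⟩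
    refine HasSecondDerivAt.sub ?_ ?_
    · refine (hd k).congr fun t => ?_
      congr 1
      module
    · by_cases hk : k = i
      · subst hk
        refine (hb k).comp_neg.congr fun t => ?_
        rw [add_smul_single_apply, if_pos rfl, ← he]
        congr 1
        module
      · refine (hb k).congr fun t => ?_
        rw [add_smul_single_apply, if_neg (Ne.symm hk)]
        congr 1
        module
  · intro y hyi _
    simp [hyi]
  · intro y hyl
    simp only
    rw [hbd _ (by rwa [hl_add]), hbd _ (by rwa [hl_add, hl_add]), sub_zero]
  · intro y _ hyl hy
    have hnorm : ∀ z : EuclideanSpace ℝ (Fin m), ‖z‖ = ‖y‖ → R₀ ≤ ‖z + a • e‖ := fun z hz => by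
      have h1 : ‖a • e‖ = |a| := by simp [he, norm_smul]
      have h2 : ‖z‖ ≤ ‖z + a • e‖ + ‖a • e‖ := by
        simpa using norm_sub_le (z + a • e) (a • e)
      linarith
    have hrefl : ‖y + (-2 * y i) • e‖ = ‖y‖ := by
      have := norm_add_smul_single_sq y i (-2 * y i)
      rw [← sq_eq_sq₀ (norm_nonneg _) (norm_nonneg _), this]
      ring
    have h1 := hgrowth (y + a • e) (by rwa [hl_add]) (hnorm y rfl)
    have h2 := hgrowth (y + (-2 * y i) • e + a • e) (by rwa [hl_add, hl_add]) (hnorm _ hrefl)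
    rw [hl_add] at h1
    rw [hl_add, hl_add] at h2
    have := (abs_le.mp h1).2
    have := (abs_le.mp h2).1
    linarith

theorem eq_add_smul_single_of_linear_growth {i : Fin m} (hil : i ≠ l)
    (hcont : ContinuousOn u {x | 0 ≤ x l})
    (hharm : ∀ x, 0 < x l → ∃ d : Fin m → ℝ, (∀ k, HasSecondDerivAt
      (fun t : ℝ => u (x + t • EuclideanSpace.single k (1 : ℝ))) (d k) 0) ∧ ∑ k, d k = 0)
    (hbd : ∀ x, x l = 0 → u x = 0) {M R₀ : ℝ} (hM : 0 < M)
    (hgrowth : ∀ x, 0 ≤ x l → R₀ ≤ ‖x‖ → |u x| ≤ M * x l)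
    {x : EuclideanSpace ℝ (Fin m)} (hxl : 0 ≤ x l) (c : ℝ) :
    u (x + c • EuclideanSpace.single i (1 : ℝ)) = u x := by
  have hneg : ∀ x, 0 < x l → ∃ d : Fin m → ℝ, (∀ k, HasSecondDerivAt
      (fun t : ℝ => -u (x + t • EuclideanSpace.single k (1 : ℝ))) (d k) 0) ∧ ∑ k, d k = 0 := by
    intro x hx
    obtain ⟨d, hd, hd0⟩ := hharm x hx
    exact ⟨fun k => -1 * d k, fun k => ((hd k).const_mul (-1)).congr fun t => by ring,
      by rw [← Finset.mul_sum, hd0, mul_zero]⟩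
  have key : ∀ (x : EuclideanSpace ℝ (Fin m)) (c : ℝ), 0 ≤ x l → c ≤ 0 →
      u (x + c • EuclideanSpace.single i (1 : ℝ)) = u x := by
    intro x c hx hc
    set e : EuclideanSpace ℝ (Fin m) := EuclideanSpace.single i (1 : ℝ) with he
    set a := x i + c / 2 with ha
    set y := x + (-a) • e with hy
    have hyi : y i = -c / 2 := by
      simp [hy, he, ha]
      ring
    have hyl : y l = x l := by simp [hy, he, hil.symm]
    have hy1 : y + a • e = x := by
      rw [hy]
      module
    have hy2 : y + (-2 * y i) • e + a • e = x + c • e := by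
      rw [hyi, hy]
      module
    have h1 := le_reflection_of_linear_growth hil hcont hharm hbd hM hgrowth a (x := y)
      (by rw [hyi]; linarith) (by rwa [hyl])
    have h2 := le_reflection_of_linear_growth (u := fun x => -u x) hil hcont.neg hneg
      (fun x hx => by rw [hbd x hx, neg_zero]) hM
      (fun x h h' => by rw [abs_neg]; exact hgrowth x h h') a (x := y)
      (by rw [hyi]; linarith) (by rwa [hyl])
    rw [← he, hy1, hy2] at h1 h2
    linarith
  rcases le_total c 0 with hc | hc
  · exact key x c hxl hc
  · have := key (x + c • EuclideanSpace.single i (1 : ℝ)) (-c) (by simpa [hil.symm] using hxl)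
      (by linarith)
    rw [← this]
    congr 1
    module

/-- A function invariant in all directions but the `l`-th depends on the `l`-th coordinate only. -/
theorem eq_apply_smul_single_of_invariant
    (h : ∀ i, i ≠ l → ∀ x : EuclideanSpace ℝ (Fin m), 0 ≤ x l → ∀ c : ℝ,
      u (x + c • EuclideanSpace.single i (1 : ℝ)) = u x)
    {x : EuclideanSpace ℝ (Fin m)} (hx : 0 ≤ x l) :
    u x = u (x l • EuclideanSpace.single l (1 : ℝ)) := by
  have key : ∀ S : Finset (Fin m), l ∉ S →
      u (x l • EuclideanSpace.single l (1 : ℝ) +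
        ∑ j ∈ S, x j • EuclideanSpace.single j (1 : ℝ)) =
      u (x l • EuclideanSpace.single l (1 : ℝ)) := by
    intro S
    induction S using Finset.induction_on with
    | empty => simp
    | insert j S hj ih =>
      intro hl
      rw [Finset.mem_insert, not_or] at hl
      rw [Finset.sum_insert hj, add_comm (x j • _), ← add_assoc, h j (Ne.symm hl.1), ih hl.2]
      have hsum : ∑ k ∈ S, x k * (if l = k then (1 : ℝ) else 0) = 0 :=
        Finset.sum_eq_zero fun k hk => by
          rw [if_neg (ne_of_mem_of_not_mem hk hl.2).symm, mul_zero]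
      simpa [Pi.single_apply, hl.2] using hx
  have hdecomp : x l • EuclideanSpace.single l (1 : ℝ) +
      ∑ j ∈ Finset.univ.erase l, x j • EuclideanSpace.single j (1 : ℝ) = x := by
    rw [Finset.add_sum_erase _ (fun j => x j • EuclideanSpace.single j (1 : ℝ)) (Finset.mem_univ l)]
    ext k
    simp [Pi.single_apply]
  rw [← key _ (Finset.notMem_erase l _), hdecomp]

end HalfSpace

/-- A continuous function on `[0, ∞)` with zero second derivative on `(0, ∞)` and value zero at the
origin is linear. -/
theorem eq_mul_of_hasSecondDerivAt_zero {g : ℝ → ℝ} (hcont : ContinuousOn g (Set.Ici 0))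
    (h0 : g 0 = 0) (hg : ∀ t, 0 < t → HasSecondDerivAt g 0 t) {t : ℝ} (ht : 0 ≤ t) :
    g t = g 1 * t := by
  have hd : ∀ t, 0 < t → DifferentiableAt ℝ g t ∧ HasDerivAt (deriv g) 0 t := by
    intro t ht
    obtain ⟨g', h1, h2⟩ := hg t ht
    refine ⟨h1.self_of_nhds.differentiableAt, h2.congr_of_eventuallyEq ?_⟩
    filter_upwards [h1] with y h using h.deriv
  obtain ⟨c, hc⟩ := isOpen_Ioi.exists_is_const_of_deriv_eq_zero (s := Set.Ioi (0 : ℝ))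
    isPreconnected_Ioi (fun t ht => (hd t ht).2.differentiableAt.differentiableWithinAt)
    (fun t ht => (hd t ht).2.deriv)
  have hlin : ∀ t, 0 < t → HasDerivAt (fun t => g t - c * t) 0 t := fun t ht => by
    have := (hd t ht).1.hasDerivAt.sub ((hasDerivAt_id t).const_mul c)
    rw [hc t ht] at this
    exact this.congr_deriv (by ring)
  obtain ⟨k, hk⟩ := isOpen_Ioi.exists_is_const_of_deriv_eq_zero (s := Set.Ioi (0 : ℝ))
    isPreconnected_Ioi (fun t ht => (hlin t ht).differentiableAt.differentiableWithinAt)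
    (fun t ht => (hlin t ht).deriv)
  have hk0 : k = 0 := by
    have h1 : Tendsto (fun t => g t - c * t) (𝓝[>] 0) (𝓝 (g 0 - c * 0)) :=
      ((hcont 0 Set.self_mem_Ici).mono Set.Ioi_subset_Ici_self).sub
        (Continuous.continuousWithinAt (by fun_prop))
    have h2 : Tendsto (fun t => g t - c * t) (𝓝[>] 0) (𝓝 k) :=
      tendsto_const_nhds.congr' (by filter_upwards [self_mem_nhdsWithin] with t ht using (hk t ht).symm)
    have := tendsto_nhds_unique h1 h2
    rw [h0] at this
    linarith
  have hgt : ∀ t, 0 < t → g t = c * t := fun t ht => by linarith [hk t ht]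
  rcases ht.eq_or_lt with rfl | ht
  · rw [h0, mul_zero]
  · rw [hgt t ht, hgt 1 one_pos, mul_one]

theorem liouville_typeI_halfspace_O (n : ℕ) (u : EuclideanSpace ℝ (Fin (n + 2)) → ℝ)
    (hcont : ContinuousOn u {x | 0 ≤ x (Fin.last (n + 1))})
    (hharm : IsHarmonicOn u {x | 0 < x (Fin.last (n + 1))})
    (hbd : ∀ x : EuclideanSpace ℝ (Fin (n + 2)), x (Fin.last (n + 1)) = 0 → u x = 0)
    (hgrowth : ∃ M R₀ : ℝ, 0 < M ∧ 0 < R₀ ∧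
      ∀ x : EuclideanSpace ℝ (Fin (n + 2)), 0 ≤ x (Fin.last (n + 1)) → R₀ ≤ ‖x‖ →
        |u x| ≤ M * x (Fin.last (n + 1))) :
    ∀ x : EuclideanSpace ℝ (Fin (n + 2)), 0 ≤ x (Fin.last (n + 1)) →
      u x = u (en n) * x (Fin.last (n + 1)) := by
  obtain ⟨M, R₀, hM, -, hgrowth⟩ := hgrowth
  set l := Fin.last (n + 1) with hl
  have hharm' := fun (x : EuclideanSpace ℝ (Fin (n + 2))) (hx : 0 < x l) =>
    hharm.hasSecondDerivAt_line (isOpen_halfSpace l) hx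
  have hinv : ∀ i, i ≠ l → ∀ x : EuclideanSpace ℝ (Fin (n + 2)), 0 ≤ x l → ∀ c : ℝ,
      u (x + c • EuclideanSpace.single i (1 : ℝ)) = u x := fun i hi x hx c =>
    eq_add_smul_single_of_linear_growth hi hcont hharm' hbd hM hgrowth hx c
  have hcoord : ∀ t : ℝ, (t • en n) l = t := fun t => by simp [en, hl]
  intro x hx
  rw [eq_apply_smul_single_of_invariant hinv hx]
  have hlin := eq_mul_of_hasSecondDerivAt_zero (g := fun t : ℝ => u (t • en n)) ?_ ?_ ?_ hx
  · rw [one_smul] at hlin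
    exact hlin
  · refine hcont.comp (Continuous.continuousOn (by fun_prop)) fun t ht => ?_
    rw [Set.mem_ofPred_eq, hcoord]
    exact ht
  · exact hbd _ (hcoord 0)
  · intro t ht
    obtain ⟨d, hd, hd0⟩ := hharm' (t • en n) (by rwa [hcoord])
    have hd' : ∀ k, k ≠ l → d k = 0 := fun k hk => by
      refine (hd k).unique ((HasSecondDerivAt.const (u (t • en n)) 0).congr fun s => ?_)
      rw [hinv k hk _ (by rw [hcoord]; exact ht.le)]
    have hdl : d l = 0 := by
      rwa [Finset.sum_eq_single l (fun k _ hk => hd' k hk) (by simp)] at hd0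
    refine HasSecondDerivAt.shift ?_
    have hdl' := hd l
    rw [hdl] at hdl'
    refine hdl'.congr fun s => ?_
    rw [add_smul]
    rfl
end
end

section
/- Let u be continuous on the closed half-space {x ∈ ℝⁿ : xₙ ≥ 0}, harmonic on the open half-space {xₙ > 0}, and u = 0 on the hyperplane {xₙ = 0}. Suppose u(x) = o(xₙ) as |x| → ∞, i.e. for every ε > 0 there exists R > 0 such that |u(x)| ≤ ε·xₙ for all x with xₙ ≥ 0 and |x| ≥ R. Then u ≡ 0 on {xₙ ≥ 0}. -/
noncomputable section

open Filter Topology in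
/-- Second-order necessary condition for a local maximum, in one variable. -/
lemma deriv_deriv_nonpos_of_isLocalMax {g : ℝ → ℝ} {a : ℝ} (hg : ContinuousAt g a)
    (h : IsLocalMax g a) : deriv (deriv g) a ≤ 0 := by
  by_contra! hpos
  have hmin : IsLocalMin g a := isLocalMin_of_deriv_deriv_pos hpos h.deriv_eq_zero hg
  have hconst : g =ᶠ[𝓝 a] fun _ => g a := by
    filter_upwards [h, hmin] with t h1 h2 using le_antisymm h1 h2
  have hzero : deriv (deriv g) a = 0 := by
    rw [hconst.deriv.deriv_eq]
    simp
  exact hpos.ne' hzero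

open Filter Topology in
/-- The derivatives along a line of a function which is C² near a point. -/
lemma hasDerivAt_line {E : Type*} [NormedAddCommGroup E] [NormedSpace ℝ E] {v : E → ℝ}
    {q : E} (hv : ContDiffAt ℝ 2 v q) (e : E) :
    (∀ᶠ t : ℝ in 𝓝 0,
      HasDerivAt (fun t : ℝ => v (q + t • e)) (fderiv ℝ v (q + t • e) e) t) ∧
    HasDerivAt (fun t : ℝ => fderiv ℝ v (q + t • e) e)
      (fderiv ℝ (fun y => fderiv ℝ v y e) q e) 0 := by
  have hline : ∀ t : ℝ, HasDerivAt (fun t : ℝ => q + t • e) e t := fun t => by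
    simpa using ((hasDerivAt_id t).smul_const e).const_add q
  have htend : Tendsto (fun t : ℝ => q + t • e) (𝓝 0) (𝓝 q) := by
    simpa using (hline 0).continuousAt.tendsto
  constructor
  · filter_upwards [htend.eventually (hv.eventually (by simp))] with t ht
    exact (ht.differentiableAt (by simp)).hasFDerivAt.comp_hasDerivAt t (hline t)
  · have hd : DifferentiableAt ℝ (fun y => fderiv ℝ v y e) q :=
      ((hv.fderiv_right (m := 1) (by norm_num)).differentiableAt (by simp)).clm_apply
        (differentiableAt_const e)
    have hd' : HasFDerivAt (fun y => fderiv ℝ v y e) (fderiv ℝ (fun y => fderiv ℝ v y e) q)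
        (q + (0 : ℝ) • e) := by
      simpa using hd.hasFDerivAt
    exact hd'.comp_hasDerivAt 0 (hline 0)

open Filter Topology in
/-- If `v - ε xₖ + δ ‖x‖²` has a local maximum at `q`, then the Laplacian of `v` at `q` is at most
`-2 δ m`. -/
lemma lapl_le_of_isLocalMax {m : ℕ} {v : EuclideanSpace ℝ (Fin m) → ℝ}
    {q : EuclideanSpace ℝ (Fin m)} (hv : ContDiffAt ℝ 2 v q) (k : Fin m) (ε δ : ℝ)
    (h : IsLocalMax (fun x => v x - ε * x k + δ * ‖x‖ ^ 2) q) :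
    lapl v q ≤ -(2 * δ * m) := by
  have key : ∀ i : Fin m, fderiv ℝ (fun y => fderiv ℝ v y (EuclideanSpace.single i 1)) q
      (EuclideanSpace.single i 1) ≤ -(2 * δ) := by
    intro i
    set e : EuclideanSpace ℝ (Fin m) := EuclideanSpace.single i 1 with he
    obtain ⟨h1, h2⟩ := hasDerivAt_line hv e
    have hnorm : ∀ t : ℝ, ‖q + t • e‖ ^ 2 = ‖q‖ ^ 2 + 2 * t * q i + t ^ 2 := fun t => by
      rw [norm_add_sq_real, inner_smul_right, norm_smul]
      simp [he, EuclideanSpace.inner_single_right]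
      ring
    set g : ℝ → ℝ := fun t => v (q + t • e) - ε * (q k + t * e k)
      + δ * (‖q‖ ^ 2 + 2 * t * q i + t ^ 2) with hgdef
    have hgd : ∀ᶠ t in 𝓝 (0 : ℝ), HasDerivAt g
        (fderiv ℝ v (q + t • e) e - ε * e k + δ * (2 * q i + 2 * t)) t := by
      filter_upwards [h1] with t ht
      have hl : HasDerivAt (fun t : ℝ => ε * (q k + t * e k)) (ε * e k) t := by
        simpa using (((hasDerivAt_id t).mul_const (e k)).const_add (q k)).const_mul ε
      have hq : HasDerivAt (fun t : ℝ => δ * (‖q‖ ^ 2 + 2 * t * q i + t ^ 2))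
          (δ * (2 * q i + 2 * t)) t := by
        simpa using ((((((hasDerivAt_id t).const_mul 2).mul_const (q i)).const_add
          (‖q‖ ^ 2)).add ((hasDerivAt_id t).pow 2)).const_mul δ)
      exact (ht.sub hl).add hq
    have hgmax : IsLocalMax g 0 := by
      have htend : Tendsto (fun t : ℝ => q + t • e) (𝓝 0) (𝓝 q) := by
        have : Continuous fun t : ℝ => q + t • e := by fun_prop
        simpa using this.tendsto 0
      filter_upwards [htend.eventually h] with t ht
      have h0 : g 0 = v q - ε * q k + δ * ‖q‖ ^ 2 := by simp [hgdef]
      rw [hnorm] at ht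
      rw [h0]
      simpa [hgdef] using ht
    have hdd : deriv (deriv g) 0
        = fderiv ℝ (fun y => fderiv ℝ v y e) q e + δ * 2 := by
      have hev : deriv g =ᶠ[𝓝 0]
          fun t => fderiv ℝ v (q + t • e) e - ε * e k + δ * (2 * q i + 2 * t) := by
        filter_upwards [hgd] with t ht using ht.deriv
      rw [hev.deriv_eq]
      have hl : HasDerivAt (fun t : ℝ => δ * (2 * q i + 2 * t)) (δ * 2) 0 := by
        simpa using (((hasDerivAt_id (0 : ℝ)).const_mul 2).const_add (2 * q i)).const_mul δ
      exact ((h2.sub_const (ε * e k)).add hl).deriv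
    have := deriv_deriv_nonpos_of_isLocalMax hgd.self_of_nhds.continuousAt hgmax
    linarith
  calc lapl v q ≤ ∑ _i : Fin m, -(2 * δ) := Finset.sum_le_sum fun i _ => key i
    _ = -(2 * δ * m) := by simp; ring

lemma IsHarmonicOn.neg {m : ℕ} {u : EuclideanSpace ℝ (Fin m) → ℝ}
    {U : Set (EuclideanSpace ℝ (Fin m))} (hu : IsHarmonicOn u U) :
    IsHarmonicOn (fun x => -u x) U := by
  refine ⟨hu.1.neg, fun x hx => ?_⟩
  have := hu.2 x hx
  simp only [lapl] at this ⊢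
  simp [fderiv_fun_neg, this]

/-- One-sided Phragmén–Lindelöf principle: a harmonic function on the half-space, vanishing on its
boundary and sublinear from above at infinity, is nonpositive. -/
lemma IsHarmonicOn.nonpos_of_halfspace {m : ℕ} (k : Fin m)
    {v : EuclideanSpace ℝ (Fin m) → ℝ}
    (hcont : ContinuousOn v {x | 0 ≤ x k}) (hharm : IsHarmonicOn v {x | 0 < x k})
    (hbd : ∀ x : EuclideanSpace ℝ (Fin m), x k = 0 → v x = 0)
    (hgrowth : ∀ ε : ℝ, 0 < ε → ∃ R : ℝ, 0 < R ∧
      ∀ x : EuclideanSpace ℝ (Fin m), 0 ≤ x k → R ≤ ‖x‖ → v x ≤ ε * x k)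
    (p : EuclideanSpace ℝ (Fin m)) (hp : 0 ≤ p k) : v p ≤ 0 := by
  by_contra! hvp
  have hpk : 0 < p k := hp.lt_of_ne fun h => hvp.ne' (hbd p h.symm)
  set ε := v p / (2 * p k) with hε
  obtain ⟨R₀, hR₀, hR⟩ := hgrowth ε (by positivity)
  have hεp : ε * p k = v p / 2 := by
    rw [hε]
    field_simp
  set R := max R₀ ‖p‖ with hRdef
  have hRpos : 0 < R := hR₀.trans_le (le_max_left _ _)
  set δ := v p / (4 * R ^ 2) with hδ
  have hδpos : 0 < δ := by positivity
  have hδR : δ * R ^ 2 = v p / 4 := by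
    rw [hδ]
    field_simp
  set f : EuclideanSpace ℝ (Fin m) → ℝ := fun x => v x - ε * x k + δ * ‖x‖ ^ 2 with hf
  have hcoord : Continuous fun x : EuclideanSpace ℝ (Fin m) => x k := by fun_prop
  have hK : IsCompact (Metric.closedBall (0 : EuclideanSpace ℝ (Fin m)) R ∩ {x | 0 ≤ x k}) :=
    (isCompact_closedBall 0 R).inter_right (isClosed_le continuous_const hcoord)
  have hfc : ContinuousOn f (Metric.closedBall 0 R ∩ {x | 0 ≤ x k}) :=
    ((hcont.mono Set.inter_subset_right).sub (by fun_prop)).add (by fun_prop)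
  have hpK : p ∈ Metric.closedBall (0 : EuclideanSpace ℝ (Fin m)) R ∩ {x | 0 ≤ x k} :=
    ⟨by simp [hRdef], hp⟩
  obtain ⟨q, hqK, hq⟩ := hK.exists_isMaxOn ⟨p, hpK⟩ hfc
  have hqR : ‖q‖ ≤ R := by simpa using hqK.1
  have hqk : 0 ≤ q k := hqK.2
  have hpq : f p ≤ f q := hq hpK
  have hqsq : δ * ‖q‖ ^ 2 ≤ δ * R ^ 2 := by gcongr
  have hpsq : 0 ≤ δ * ‖p‖ ^ 2 := by positivity
  have hvq : ε * q k < v q := by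
    simp only [hf] at hpq
    linarith
  have hqpos : 0 < q k := hqk.lt_of_ne fun h => by
    rw [← h, hbd q h.symm] at hvq
    simp at hvq
  have hqlt : ‖q‖ < R := by
    by_contra! hle
    exact absurd (hR q hqk ((le_max_left _ _).trans hle)) hvq.not_ge
  have hopen : IsOpen {x : EuclideanSpace ℝ (Fin m) | 0 < x k} :=
    isOpen_lt continuous_const hcoord
  have hmax : IsLocalMax f q := by
    refine hq.isLocalMax (Filter.inter_mem ?_ ?_)
    · exact Filter.mem_of_superset (Metric.isOpen_ball.mem_nhds (by simpa using hqlt))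
        Metric.ball_subset_closedBall
    · exact Filter.mem_of_superset (hopen.mem_nhds hqpos) fun x (hx : 0 < x k) => hx.le
  have hlap := lapl_le_of_isLocalMax (hharm.1.contDiffAt (hopen.mem_nhds hqpos)) k ε δ hmax
  rw [hharm.2 q hqpos] at hlap
  have hm : (0 : ℝ) < m := Nat.cast_pos.2 k.pos
  have : 0 < 2 * δ * m := by positivity
  linarith

theorem liouville_typeI_halfspace_o (n : ℕ) (u : EuclideanSpace ℝ (Fin (n + 2)) → ℝ)
    (hcont : ContinuousOn u {x | 0 ≤ x (Fin.last (n + 1))})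
    (hharm : IsHarmonicOn u {x | 0 < x (Fin.last (n + 1))})
    (hbd : ∀ x : EuclideanSpace ℝ (Fin (n + 2)), x (Fin.last (n + 1)) = 0 → u x = 0)
    (hgrowth : ∀ ε : ℝ, 0 < ε → ∃ R : ℝ, 0 < R ∧
      ∀ x : EuclideanSpace ℝ (Fin (n + 2)), 0 ≤ x (Fin.last (n + 1)) → R ≤ ‖x‖ →
        |u x| ≤ ε * x (Fin.last (n + 1))) :
    ∀ x : EuclideanSpace ℝ (Fin (n + 2)), 0 ≤ x (Fin.last (n + 1)) → u x = 0 := by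
  intro x hx
  refine le_antisymm (hharm.nonpos_of_halfspace _ hcont hbd (fun ε hε => ?_) x hx)
    (neg_nonpos.1 (hharm.neg.nonpos_of_halfspace _ hcont.neg
      (fun y hy => by simp [hbd y hy]) (fun ε hε => ?_) x hx))
  all_goals
    obtain ⟨R, hR, hle⟩ := hgrowth ε hε
    refine ⟨R, hR, fun y hy hRy => ?_⟩
  · exact (le_abs_self _).trans (hle y hy hRy)
  · exact (neg_le_abs _).trans (hle y hy hRy)
end
end
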